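/- arXiv:2105.12982 — 2 statements merged into one kernel-verified Lean document; each statement's English description precedes it below -/
import Mathlib

section
/- Let q ∈ ℕ, κ ∈ ℕ^q, K = {α ∈ ℕ^q : α_i ≤ κ_i for all i}, d ∈ ℕ, and let w : K → ℝ_{≥0} be a weight function such that w(α) > 0 implies Σ_i α_i = d. Suppose w satisfies the multiplicative exchange property (equivalently, log w is M-concave, with log 0 = −∞): for all α, β ∈ K with w(α) > 0 and w(β) > 0, and for every index i with α_i > β_i, there exists an index j with α_j < β_j such that w(α)·w(β) ≤ w(α − e_i + e_j)·w(β + e_i − e_j). Then the d-homogeneous polynomial g(x₁,…,x_q) = Σ_{α ∈ K} (w(α)/α!) x^α, where α! = Π_i α_i! and x^α = Π_i x_i^{α_i}, is strongly log-concave. -/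
open Finset MvPolynomial

/-- Iterated partial derivative `∂^β p`, applying `∂/∂x_i` exactly `β i` times. -/
noncomputable def pderivMulti {q : ℕ} (β : Fin q → ℕ) (p : MvPolynomial (Fin q) ℝ) :
    MvPolynomial (Fin q) ℝ :=
  (List.finRange q).foldr (fun i acc => (fun r => MvPolynomial.pderiv i r)^[β i] acc) p

/-- A polynomial `p ∈ ℝ[x₁,…,x_q]` (with nonnegative coefficients) is strongly
log-concave if for every `β ∈ ℕ^q`, writing `p_β = ∂^β p`, and every `x ≥ 0` with
`p_β(x) > 0`, the matrix with entries
`p_β(x)·(∂_i ∂_j p_β)(x) − (∂_i p_β)(x)·(∂_j p_β)(x)` is negative semidefinite. -/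
noncomputable def StronglyLogConcave {q : ℕ} (p : MvPolynomial (Fin q) ℝ) : Prop :=
  ∀ β : Fin q → ℕ, ∀ x : Fin q → ℝ, (∀ i, 0 ≤ x i) →
    0 < MvPolynomial.eval x (pderivMulti β p) →
    (-(Matrix.of fun i j : Fin q =>
        MvPolynomial.eval x (pderivMulti β p)
            * MvPolynomial.eval x (MvPolynomial.pderiv i (MvPolynomial.pderiv j (pderivMulti β p)))
          - MvPolynomial.eval x (MvPolynomial.pderiv i (pderivMulti β p))
            * MvPolynomial.eval x (MvPolynomial.pderiv j (pderivMulti β p)))).PosSemidef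

/-- `exchangeMove α i j = α − e_i + e_j`. -/
def exchangeMove {q : ℕ} (α : Fin q → ℕ) (i j : Fin q) : Fin q → ℕ :=
  fun l => α l + (if l = j then 1 else 0) - (if l = i then 1 else 0)

/-- The bilinear form of a matrix, written as an explicit double sum. -/
def bil {ι : Type*} [Fintype ι] (M : ι → ι → ℝ) (u v : ι → ℝ) : ℝ :=
  ∑ i, ∑ j, u i * M i j * v j

lemma bil_symm {ι : Type*} [Fintype ι] {M : ι → ι → ℝ} (hs : ∀ i j, M i j = M j i)
    (u v : ι → ℝ) : bil M u v = bil M v u := by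
  unfold bil
  rw [Finset.sum_comm]
  refine Finset.sum_congr rfl fun i _ => Finset.sum_congr rfl fun j _ => ?_
  rw [hs j i]; ring

lemma bil_sub {ι : Type*} [Fintype ι] {M : ι → ι → ℝ} (hs : ∀ i j, M i j = M j i)
    (v x : ι → ℝ) (t : ℝ) : bil M (fun i => v i - t * x i) (fun i => v i - t * x i)
      = bil M v v - 2 * t * bil M v x + t ^ 2 * bil M x x := by
  have h := bil_symm hs x v
  have : bil M (fun i => v i - t * x i) (fun i => v i - t * x i)
      = bil M v v - t * bil M v x - t * bil M x v + t ^ 2 * bil M x x := by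
    unfold bil
    simp only [Finset.mul_sum, ← Finset.sum_sub_distrib, ← Finset.sum_add_distrib]
    refine Finset.sum_congr rfl fun i _ => Finset.sum_congr rfl fun j _ => ?_
    ring
  rw [this, h]; ring

lemma hr_of_neg {ι : Type*} [Fintype ι] {M : ι → ι → ℝ} (hs : ∀ i j, M i j = M j i)
    (v x : ι → ℝ) (t : ℝ) (hx : 0 ≤ bil M x x)
    (h : bil M (fun i => v i - t * x i) (fun i => v i - t * x i) ≤ 0) :
    bil M v v * bil M x x ≤ (bil M v x) ^ 2 := by
  rw [bil_sub hs] at h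
  nlinarith [sq_nonneg (t * bil M x x - bil M v x), mul_le_mul_of_nonneg_right h hx]

/-- A partial equivalence relation gives a positive semidefinite 0/1 matrix. -/
lemma per_psd {ι : Type*} [Fintype ι] [DecidableEq ι] (R : ι → ι → Prop) [DecidableRel R]
    (hs : ∀ i j, R i j → R j i) (ht : ∀ i j k, R i j → R j k → R i k) (v : ι → ℝ) :
    0 ≤ ∑ i, ∑ j, v i * v j * (if R i j then 1 else 0) := by
  classical
  let f : ι → Finset ι := fun i => Finset.univ.filter (fun j => R i j)
  have key : ∀ i j, (if R i j then (1:ℝ) else 0) =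
      ∑ c ∈ (Finset.univ : Finset (Finset ι)).filter (fun c => c.Nonempty),
        (if f i = c then 1 else 0) * (if f j = c then 1 else 0) := by
    intro i j
    by_cases h : R i j
    · have e : f i = f j := by
        ext k; simp only [f, Finset.mem_filter, Finset.mem_univ, true_and]
        exact ⟨fun hk => ht _ _ _ (hs _ _ h) hk, fun hk => ht _ _ _ h hk⟩
      have hn : (f j).Nonempty := ⟨j, by simp [f, ht _ _ _ (hs _ _ h) h]⟩
      simp [h, e, hn]
    · rw [if_neg h]
      symm
      refine Finset.sum_eq_zero fun c hc => ?_
      obtain ⟨k, hk⟩ := (Finset.mem_filter.1 hc).2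
      by_cases h1 : f i = c
      · by_cases h2 : f j = c
        · exfalso
          have a1 : R i k := by rw [← h1] at hk; simpa [f] using hk
          have a2 : R j k := by rw [← h2] at hk; simpa [f] using hk
          exact h (ht _ _ _ a1 (hs _ _ a2))
        · simp [h2]
      · simp [h1]
  have : ∑ i, ∑ j, v i * v j * (if R i j then (1:ℝ) else 0) =
      ∑ c ∈ (Finset.univ : Finset (Finset ι)).filter (fun c => c.Nonempty),
        (∑ i, v i * (if f i = c then 1 else 0)) ^ 2 := by
    simp_rw [key, sq, Finset.sum_mul_sum, Finset.mul_sum]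
    conv_rhs => rw [Finset.sum_comm]
    refine Finset.sum_congr rfl fun i _ => ?_
    rw [Finset.sum_comm]
    refine Finset.sum_congr rfl fun c _ => Finset.sum_congr rfl fun j _ => ?_
    ring
  rw [this]
  positivity

/-- Ultrametric matrices are conditionally negative semidefinite. -/
lemma ultra_neg {ι : Type*} [Fintype ι] [DecidableEq ι] (S : ι → ι → ℝ) (h0 : ∀ i j, 0 ≤ S i j)
    (hs : ∀ i j, S i j = S j i) (hu : ∀ i j k, S i j ≤ max (S i k) (S k j)) (v : ι → ℝ)
    (hv : ∑ i, v i = 0) : ∑ i, ∑ j, v i * v j * S i j ≤ 0 := by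
  have hI : ∀ i j, ∫ t : ℝ, (Set.Ico 0 (S i j)).indicator (fun _ => (1:ℝ)) t = S i j := by
    intro i j
    rw [MeasureTheory.integral_indicator measurableSet_Ico]
    simp [h0 i j]
  have hInt : ∀ i j, MeasureTheory.Integrable
      (fun t : ℝ => v i * v j * (Set.Ico 0 (S i j)).indicator (fun _ => (1:ℝ)) t) := by
    intro i j
    refine MeasureTheory.Integrable.const_mul ?_ _
    rw [MeasureTheory.integrable_indicator_iff measurableSet_Ico]
    simp
  have e : ∑ i, ∑ j, v i * v j * S i j = ∫ t : ℝ, ∑ i, ∑ j,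
      v i * v j * (Set.Ico 0 (S i j)).indicator (fun _ => (1:ℝ)) t := by
    rw [MeasureTheory.integral_finsetSum _ (fun i _ => MeasureTheory.integrable_finsetSum _ (fun j _ => hInt i j))]
    refine Finset.sum_congr rfl fun i _ => ?_
    rw [MeasureTheory.integral_finsetSum _ (fun j _ => hInt i j)]
    refine Finset.sum_congr rfl fun j _ => ?_
    rw [MeasureTheory.integral_const_mul, hI]
  rw [e]
  refine MeasureTheory.integral_nonpos fun t => ?_
  by_cases ht : 0 ≤ t
  · have h1 := per_psd (fun i j => S i j ≤ t) (fun i j h => by rwa [hs j i])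
      (fun i j k h h' => (hu i k j).trans (max_le h h')) v
    have h2 : ∑ i, ∑ j, v i * v j = 0 := by
      rw [← Finset.sum_mul_sum, hv, zero_mul]
    have h3 : ∑ i, ∑ j, v i * v j * (Set.Ico 0 (S i j)).indicator (fun _ => (1:ℝ)) t =
        ∑ i, ∑ j, v i * v j - ∑ i, ∑ j, v i * v j * (if S i j ≤ t then 1 else 0) := by
      simp only [← Finset.sum_sub_distrib]
      refine Finset.sum_congr rfl fun i _ => Finset.sum_congr rfl fun j _ => ?_
      by_cases h : S i j ≤ t
      · simp [h]
      · simp [h, Set.indicator, ht, not_le.1 h]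
    simp only [Pi.zero_apply]
    rw [h3, h2]; linarith
  · have : ∀ i j, (Set.Ico 0 (S i j)).indicator (fun _ => (1:ℝ)) t = 0 := by
      intro i j; simp [Set.indicator, ht]
    simp [this]

/-- The quadratic case: a nonnegative symmetric matrix with the four-point condition. -/
lemma four_point_hr {ι : Type*} [Fintype ι] [DecidableEq ι] (A : ι → ι → ℝ)
    (h0 : ∀ i j, 0 ≤ A i j)
    (hs : ∀ i j, A i j = A j i)
    (h4 : ∀ i j k l, A i j * A k l ≤ max (A i k * A j l) (A i l * A j k))
    (x : ι → ℝ) (hx : ∀ i, 0 < x i) (v : ι → ℝ) :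
    bil A v v * bil A x x ≤ (bil A v x) ^ 2 := by
  by_cases hA : ∃ o m, 0 < A o m
  swap
  · have : ∀ i j, A i j = 0 := fun i j => by
      by_contra h
      exact hA ⟨i, j, lt_of_le_of_ne (h0 i j) (Ne.symm h)⟩
    simp [bil, this]
  obtain ⟨o, m, hm⟩ := hA
  have hxx : 0 ≤ bil A x x := Finset.sum_nonneg fun i _ => Finset.sum_nonneg fun j _ =>
    mul_nonneg (mul_nonneg (hx i).le (h0 i j)) (hx j).le
  have hpos : 0 < ∑ j, A o j * x j := Finset.sum_pos' (fun j _ => mul_nonneg (h0 o j) (hx j).le)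
    ⟨m, Finset.mem_univ _, mul_pos hm (hx m)⟩
  refine hr_of_neg hs v x ((∑ j, A o j * v j) / (∑ j, A o j * x j)) hxx ?_
  generalize hy : (fun i => v i - (∑ j, A o j * v j) / (∑ j, A o j * x j) * x i) = y
  have hy0 : ∑ j, A o j * y j = 0 := by
    rw [← hy]
    simp only [mul_sub, Finset.sum_sub_distrib]
    have : ∀ t : ℝ, ∑ j, A o j * (t * x j) = t * ∑ j, A o j * x j := by
      intro t; rw [Finset.mul_sum]; exact Finset.sum_congr rfl fun j _ => by ring
    rw [this, div_mul_cancel₀ _ hpos.ne', sub_self]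
  clear hy
  -- ultrametric matrix
  let S : ι → ι → ℝ := fun i j => A i j / (A o i * A o j)
  have hS0 : ∀ i j, 0 ≤ S i j := fun i j => div_nonneg (h0 _ _) (mul_nonneg (h0 _ _) (h0 _ _))
  -- rows with `A o i = 0`
  have hZ : ∀ i, A o i = 0 → ∀ j, A i j = A i m / A o m * A o j := by
    intro i hi j
    have e1 := h4 i j o m
    have e2 := h4 i m o j
    rw [hs i o, hi, hs j o, hs m j] at *
    simp only [zero_mul] at e1 e2
    have p1 : 0 ≤ A i m * A o j := mul_nonneg (h0 _ _) (h0 _ _)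
    have p2 : 0 ≤ A i j * A o m := mul_nonneg (h0 _ _) (h0 _ _)
    rw [hs m o, max_eq_right p2] at e2
    rw [max_eq_right p1] at e1
    field_simp
    linarith
  let P : Finset ι := Finset.univ.filter (fun i => A o i ≠ 0)
  have hz : ∀ i, A o i = 0 → ∑ j, y i * A i j * y j = 0 := by
    intro i hi
    have : ∑ j, y i * A i j * y j = y i * (A i m / A o m) * ∑ j, A o j * y j := by
      rw [Finset.mul_sum]
      refine Finset.sum_congr rfl fun j _ => ?_
      rw [hZ i hi j]; ring
    rw [this, hy0, mul_zero]
  have hzz : ∀ i j, A o i = 0 → A o j = 0 → A i j = 0 := by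
    intro i j hi hj; rw [hZ i hi j, hj, mul_zero]
  have hcol : ∀ j, A o j = 0 → ∑ i, y i * A i j * y j = 0 := by
    intro j hj
    rw [← hz j hj]
    refine Finset.sum_congr rfl fun i _ => ?_
    rw [hs i j]; ring
  let u : ι → ℝ := fun i => A o i * y i
  have hP : ∑ i : P, u i = 0 := by
    rw [Finset.sum_coe_sort P u, Finset.sum_filter_of_ne, hy0]
    intro i _ h h'; exact h (by simp [u, h'])
  have hPne : ∀ i : P, 0 < A o i := fun i =>
    lt_of_le_of_ne (h0 _ _) (Ne.symm (Finset.mem_filter.1 i.2).2)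
  have key := ultra_neg (fun i j : P => S i j) (fun i j => hS0 _ _)
    (fun i j => by simp only [S]; rw [hs i j, mul_comm]) (fun i j k => by
      have hi := hPne i
      have hj := hPne j
      have hk := hPne k
      have := h4 i j k o
      simp only [S, le_max_iff] at this ⊢
      rw [hs k o, hs j o, hs i o, hs j k] at this
      rcases this with h | h
      · left
        rw [div_le_div_iff₀ (by positivity) (by positivity)]
        nlinarith
      · right
        rw [div_le_div_iff₀ (by positivity) (by positivity)]
        nlinarith) (fun i : P => u i) hP
  have e1 : ∑ i : P, ∑ j : P, u i * u j * S i j = ∑ i ∈ P, ∑ j ∈ P, y i * A i j * y j := by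
    rw [Finset.sum_coe_sort P (fun i => ∑ j : P, u i * u j * S i j)]
    refine Finset.sum_congr rfl fun i hi => ?_
    rw [Finset.sum_coe_sort P (fun j => u i * u j * S i j)]
    refine Finset.sum_congr rfl fun j hj => ?_
    have hi' := (Finset.mem_filter.1 hi).2
    have hj' := (Finset.mem_filter.1 hj).2
    simp only [u, S]
    field_simp
  have e2 : bil A y y = ∑ i ∈ P, ∑ j, y i * A i j * y j := by
    unfold bil
    symm
    refine Finset.sum_subset (Finset.subset_univ _) fun i _ hi => hz i ?_
    simpa [P] using hi
  have e3 : ∑ i ∈ P, ∑ j, y i * A i j * y j = ∑ i ∈ P, ∑ j ∈ P, y i * A i j * y j := by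
    rw [Finset.sum_comm, Finset.sum_comm (s := P) (t := P)]
    symm
    refine Finset.sum_subset (Finset.subset_univ _) fun j _ hj => ?_
    have hj' : A o j = 0 := by simpa [P] using hj
    rw [← hcol j hj']
    refine Finset.sum_subset (Finset.subset_univ _) fun i _ hi => ?_
    rw [hzz i j (by simpa [P] using hi) hj']; ring
  rw [e2, e3, ← e1]
  exact key

/-- Spectral theorem in coordinates. -/
lemma spectral_coords {ι : Type*} [Fintype ι] [DecidableEq ι] (N : ι → ι → ℝ)
    (hs : ∀ i j, N i j = N j i) :
    ∃ (e : ι → ι → ℝ) (l : ι → ℝ), (∀ k, e k ≠ 0) ∧ (∀ k i, ∑ j, N i j * e k j = l k * e k i) ∧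
      ∀ z, bil N z z = ∑ k, l k * (∑ i, z i * e k i) ^ 2 := by
  have hN : (Matrix.of N).IsHermitian := by
    ext i j; simp [hs j i]
  refine ⟨fun k => (hN.eigenvectorBasis k).ofLp, hN.eigenvalues, ?_, ?_, ?_⟩
  · intro k h
    have := hN.eigenvectorBasis.orthonormal.ne_zero k
    apply this
    ext i
    exact congrFun h i
  · intro k i
    have := congrFun (hN.mulVec_eigenvectorBasis k) i
    simpa [Matrix.mulVec, dotProduct] using this
  · intro z
    have h1 : bil N z z = inner ℝ (WithLp.toLp 2 z) (WithLp.toLp 2 ((Matrix.of N).mulVec z)) := by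
      simp only [bil, PiLp.inner_apply, Matrix.mulVec, dotProduct, Matrix.of_apply]
      refine Finset.sum_congr rfl fun i _ => ?_
      simp [Finset.sum_mul]
      refine Finset.sum_congr rfl fun j _ => ?_
      ring
    rw [h1, ← hN.eigenvectorBasis.sum_inner_mul_inner]
    refine Finset.sum_congr rfl fun k _ => ?_
    have h2 : inner ℝ (WithLp.toLp 2 z) (hN.eigenvectorBasis k) =
        ∑ i, z i * (hN.eigenvectorBasis k).ofLp i := by
      simp only [PiLp.inner_apply]
      refine Finset.sum_congr rfl fun i _ => ?_
      simp [mul_comm]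
    have h3 : inner ℝ (hN.eigenvectorBasis k) (WithLp.toLp 2 ((Matrix.of N).mulVec z)) =
        hN.eigenvalues k * ∑ i, z i * (hN.eigenvectorBasis k).ofLp i := by
      have := hN.mulVec_eigenvectorBasis k
      have e1 : inner ℝ (hN.eigenvectorBasis k) (WithLp.toLp 2 ((Matrix.of N).mulVec z)) =
        (hN.eigenvectorBasis k).ofLp ⬝ᵥ ((Matrix.of N).mulVec z) := by
        simp only [PiLp.inner_apply, dotProduct]
        refine Finset.sum_congr rfl fun i _ => ?_
        simp [mul_comm]
      rw [e1, Matrix.dotProduct_mulVec, ← Matrix.mulVec_transpose]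
      have ht : (Matrix.of N).transpose = Matrix.of N := by ext i j; simp [hs j i]
      rw [ht, this]
      simp only [dotProduct, Finset.mul_sum, Pi.smul_apply, smul_eq_mul]
      refine Finset.sum_congr rfl fun i _ => ?_
      ring
    rw [h2, h3]; ring

/-- The local-to-global step. -/
lemma hr_step {ι : Type*} [Fintype ι] [DecidableEq ι] (M : ι → ι → ℝ) (H : ι → ι → ι → ℝ)
    (x : ι → ℝ) (c : ℝ) (hx : ∀ i, 0 < x i) (hM0 : ∀ i j, 0 ≤ M i j)
    (hs : ∀ i j, M i j = M j i) (hc : 0 < c) (hH0 : ∀ k i j, 0 ≤ H k i j)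
    (hE : ∀ i j, ∑ k, x k * H k i j = c * M i j)
    (hE' : ∀ k i, ∑ j, H k i j * x j = c * M k i)
    (hH : ∀ k v, bil (H k) v v * bil (H k) x x ≤ (bil (H k) v x) ^ 2)
    (hconn : ∀ u : ι → ℝ, (∀ a b, 0 < M a b → u a = u b) →
      ∀ i j, 0 < ∑ l, M i l * x l → 0 < ∑ l, M j l * x l → u i = u j)
    (v : ι → ℝ) :
    bil M v v * bil M x x ≤ (bil M v x) ^ 2 := by
  obtain ⟨r, hr⟩ : ∃ r : ι → ℝ, ∀ i, r i = ∑ l, M i l * x l := ⟨_, fun i => rfl⟩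
  simp only [← hr] at hconn
  have hr0 : ∀ i, 0 ≤ r i := fun i => by
    rw [hr]; exact Finset.sum_nonneg fun l _ => mul_nonneg (hM0 _ _) (hx l).le
  have hrz : ∀ i, r i = 0 → ∀ j, M i j = 0 := by
    intro i hi j
    rw [hr, Finset.sum_eq_zero_iff_of_nonneg
      (fun l _ => mul_nonneg (hM0 _ _) (hx l).le)] at hi
    have := hi j (Finset.mem_univ _)
    rcases mul_eq_zero.1 this with h | h
    · exact h
    · exact absurd h (hx j).ne'
  have hbx : ∀ y, bil M y x = ∑ i, y i * r i := by
    intro y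
    unfold bil
    refine Finset.sum_congr rfl fun i _ => ?_
    rw [hr, Finset.mul_sum]
    exact Finset.sum_congr rfl fun j _ => by ring
  have hxx : 0 ≤ bil M x x := by
    rw [hbx]; exact Finset.sum_nonneg fun i _ => mul_nonneg (hx i).le (hr0 i)
  rcases hxx.eq_or_lt with hxx0 | hxxp
  · rw [← hxx0, mul_zero]; positivity
  -- the key inequality
  have hkey : ∀ y : ι → ℝ, bil M y y ≤ ∑ k, x k * ((∑ j, M k j * y j) ^ 2 / r k) := by
    intro y
    have hk : ∀ k, bil (H k) y y ≤ c * ((∑ j, M k j * y j) ^ 2 / r k) := by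
      intro k
      have b1 : ∀ y, bil (H k) y x = c * ∑ i, M k i * y i := by
        intro y
        unfold bil
        rw [Finset.mul_sum]
        refine Finset.sum_congr rfl fun i _ => ?_
        rw [← mul_assoc, ← hE', Finset.sum_mul]
        exact Finset.sum_congr rfl fun j _ => by ring
      rcases (hr0 k).eq_or_lt with h | h
      · have hz : ∀ i j, H k i j = 0 := by
          intro i j
          have := hE' k i
          rw [hrz k h.symm i, mul_zero, Finset.sum_eq_zero_iff_of_nonneg
            (fun l _ => mul_nonneg (hH0 _ _ _) (hx l).le)] at this
          rcases mul_eq_zero.1 (this j (Finset.mem_univ _)) with h | h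
          · exact h
          · exact absurd h (hx j).ne'
        simp [bil, hz, ← h]
      · have := hH k y
        rw [b1, b1, ← hr k] at this
        rw [mul_div_assoc', le_div_iff₀ h]
        have h2 : c * (bil (H k) y y * r k) ≤ c * (c * (∑ j, M k j * y j) ^ 2) := by
          linarith
        exact le_of_mul_le_mul_left h2 hc
    have e : c * bil M y y = ∑ k, x k * bil (H k) y y := by
      unfold bil
      simp only [Finset.mul_sum]
      rw [Finset.sum_comm]
      conv_rhs => rw [Finset.sum_comm]
      rw [Finset.sum_comm]
      refine Finset.sum_congr rfl fun i _ => ?_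
      rw [Finset.sum_comm (s := (Finset.univ : Finset ι))]
      refine Finset.sum_congr rfl fun j _ => ?_
      have : ∑ k, x k * (y i * H k i j * y j) = y i * y j * ∑ k, x k * H k i j := by
        rw [Finset.mul_sum]; exact Finset.sum_congr rfl fun k _ => by ring
      rw [this, hE]; ring
    have h2 : c * bil M y y ≤ c * ∑ k, x k * ((∑ j, M k j * y j) ^ 2 / r k) := by
      rw [e, Finset.mul_sum]
      refine Finset.sum_le_sum fun k _ => ?_
      calc x k * bil (H k) y y ≤ x k * (c * ((∑ j, M k j * y j) ^ 2 / r k)) :=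
            mul_le_mul_of_nonneg_left (hk k) (hx k).le
        _ = _ := by ring
    exact le_of_mul_le_mul_left h2 hc
  -- Perron inequality
  have hperron : ∀ u : ι → ℝ, ∑ i, ∑ j, M i j * x i * x j * (u i - u j) ^ 2 =
      2 * (∑ i, r i * x i * u i ^ 2 - bil M (fun i => u i * x i) (fun i => u i * x i)) := by
    intro u
    have e1 : ∑ i, r i * x i * u i ^ 2 = ∑ i, ∑ j, M i j * x i * x j * u i ^ 2 := by
      refine Finset.sum_congr rfl fun i _ => ?_
      rw [hr, Finset.sum_mul, Finset.sum_mul]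
      exact Finset.sum_congr rfl fun j _ => by ring
    have e2 : ∑ i, r i * x i * u i ^ 2 = ∑ i, ∑ j, M i j * x i * x j * u j ^ 2 := by
      rw [e1, Finset.sum_comm]
      refine Finset.sum_congr rfl fun i _ => Finset.sum_congr rfl fun j _ => ?_
      rw [hs j i]; ring
    have e3 : ∑ i, ∑ j, M i j * x i * x j * (u i - u j) ^ 2 =
       ∑ i, ∑ j, M i j * x i * x j * u i ^ 2 + ∑ i, ∑ j, M i j * x i * x j * u j ^ 2
        - 2 * bil M (fun i => u i * x i) (fun i => u i * x i) := by
      unfold bil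
      simp only [Finset.mul_sum, ← Finset.sum_sub_distrib, ← Finset.sum_add_distrib]
      refine Finset.sum_congr rfl fun i _ => Finset.sum_congr rfl fun j _ => ?_
      ring
    rw [e3, ← e1, ← e2]; ring
  -- normalisation
  obtain ⟨s, hsdef⟩ : ∃ s : ι → ℝ, ∀ i, s i = Real.sqrt (r i / x i) := ⟨_, fun i => rfl⟩
  have hs0 : ∀ i, 0 ≤ s i := fun i => by rw [hsdef]; positivity
  have hs2 : ∀ i, s i ^ 2 * x i = r i := by
    intro i
    rw [hsdef, Real.sq_sqrt (div_nonneg (hr0 i) (hx i).le), div_mul_cancel₀ _ (hx i).ne']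
  have hsz : ∀ i, s i = 0 → ∀ j, M i j = 0 := by
    intro i hi
    apply hrz
    rw [← hs2, hi]; ring
  obtain ⟨N, hN⟩ : ∃ N : ι → ι → ℝ, ∀ i j, N i j = M i j / (s i * s j) := ⟨_, fun i j => rfl⟩
  have hNs : ∀ i j, N i j = N j i := by
    intro i j; rw [hN, hN, hs i j, mul_comm (s i)]
  have hNM : ∀ i j, M i j = s i * N i j * s j := by
    intro i j
    by_cases h1 : s i = 0
    · rw [hsz i h1, h1]; ring
    by_cases h2 : s j = 0
    · rw [hs, hsz j h2, h2]; ring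
    rw [hN]; field_simp
  obtain ⟨e, l, hne, hev, hq⟩ := spectral_coords N hNs
  have hpos : ∀ k, 0 < l k → ∃ a, ∀ i, e k i = a * (s i * x i) := by
    intro k hk
    -- rows with `s i = 0`
    have hez : ∀ i, s i = 0 → e k i = 0 := by
      intro i hi
      have := hev k i
      have h0 : ∑ j, N i j * e k j = 0 := Finset.sum_eq_zero fun j _ => by
        rw [hN, hsz i hi]; simp
      rw [h0] at this
      rcases mul_eq_zero.1 this.symm with h | h
      · exact absurd h hk.ne'
      · exact h
    obtain ⟨u, hu⟩ : ∃ u : ι → ℝ, ∀ i, u i = e k i / (s i * x i) := ⟨_, fun i => rfl⟩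
    have heu : ∀ i, e k i = s i * (u i * x i) := by
      intro i
      by_cases h : s i = 0
      · rw [hez i h, h, zero_mul]
      · have := (hx i).ne'
        rw [hu]; field_simp
    have hMu : ∀ i, ∑ j, M i j * (u j * x j) = l k * (s i * e k i) := by
      intro i
      have := hev k i
      calc ∑ j, M i j * (u j * x j) = s i * ∑ j, N i j * e k j := by
            rw [Finset.mul_sum]
            refine Finset.sum_congr rfl fun j _ => ?_
            rw [hNM, heu j]; ring
        _ = _ := by rw [this]; ring
    obtain ⟨E, hE1⟩ : ∃ E : ℝ, E = ∑ i, e k i ^ 2 := ⟨_, rfl⟩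
    have hEpos : 0 < E := by
      rw [hE1]
      obtain ⟨i, hi⟩ := Function.ne_iff.1 (hne k)
      exact Finset.sum_pos' (fun j _ => sq_nonneg _) ⟨i, Finset.mem_univ _, by
        have : e k i ≠ 0 := hi
        positivity⟩
    have hbu : bil M (fun i => u i * x i) (fun i => u i * x i) = l k * E := by
      unfold bil
      rw [hE1, Finset.mul_sum]
      refine Finset.sum_congr rfl fun i _ => ?_
      have : ∑ j, u i * x i * M i j * (u j * x j) = u i * x i * ∑ j, M i j * (u j * x j) := by
        rw [Finset.mul_sum]; exact Finset.sum_congr rfl fun j _ => by ring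
      rw [this, hMu]
      have := heu i
      calc u i * x i * (l k * (s i * e k i)) = l k * (s i * (u i * x i)) * e k i := by ring
        _ = _ := by rw [← this]; ring
    have h1 : l k * E ≤ l k ^ 2 * E := by
      have := hkey (fun i => u i * x i)
      rw [hbu] at this
      refine this.trans (le_of_eq ?_)
      rw [hE1, Finset.mul_sum]
      refine Finset.sum_congr rfl fun i _ => ?_
      rw [hMu]
      by_cases h : s i = 0
      · rw [hez i h]; simp
      · rw [← hs2]
        have := (hx i).ne'
        field_simp
    have hl1 : 1 ≤ l k := by
      have h2 : l k * E * 1 ≤ l k * E * l k := by linarith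
      exact le_of_mul_le_mul_left h2 (mul_pos hk hEpos)
    have hrE : ∑ i, r i * x i * u i ^ 2 = E := by
      rw [hE1]
      refine Finset.sum_congr rfl fun i _ => ?_
      rw [heu, ← hs2]; ring
    have hp := hperron u
    rw [hbu, hrE] at hp
    have hle : ∑ i, ∑ j, M i j * x i * x j * (u i - u j) ^ 2 ≤ 0 := by
      rw [hp]; nlinarith
    have hnn : ∀ i j, 0 ≤ M i j * x i * x j * (u i - u j) ^ 2 := fun i j =>
      mul_nonneg (mul_nonneg (mul_nonneg (hM0 i j) (hx i).le) (hx j).le) (sq_nonneg _)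
    have hedge : ∀ a b, 0 < M a b → u a = u b := by
      intro a b hab
      have h1 : M a b * x a * x b * (u a - u b) ^ 2 ≤ 0 :=
        ((Finset.single_le_sum (f := fun j => M a j * x a * x j * (u a - u j) ^ 2)
          (fun j _ => hnn a j) (Finset.mem_univ b)).trans
          (Finset.single_le_sum (f := fun i => ∑ j, M i j * x i * x j * (u i - u j) ^ 2)
          (fun i _ => Finset.sum_nonneg fun j _ => hnn i j) (Finset.mem_univ a))).trans hle
      have h2 : 0 < M a b * x a * x b := mul_pos (mul_pos hab (hx a)) (hx b)
      have h3 : (u a - u b) ^ 2 ≤ 0 := by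
        by_contra h
        exact absurd (mul_pos h2 (not_le.1 h)) (not_lt.2 h1)
      have h4 : u a - u b = 0 := pow_eq_zero_iff (two_ne_zero) |>.1 (le_antisymm h3 (sq_nonneg _))
      linarith
    have hcon := hconn u hedge
    obtain ⟨i0, hi0⟩ := Function.ne_iff.1 (hne k)
    have hrp : ∀ i, s i ≠ 0 → 0 < r i := fun i hi => by
      rw [← hs2]; have := hx i; positivity
    have hi0' : s i0 ≠ 0 := fun h => hi0 (hez i0 h)
    refine ⟨u i0, fun i => ?_⟩
    by_cases h : s i = 0
    · rw [hez i h, h]; ring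
    · rw [heu, hcon i i0 (hrp i h) (hrp i0 hi0')]; ring
  refine hr_of_neg hs v x (bil M v x / bil M x x) hxx ?_
  generalize hy : (fun i => v i - bil M v x / bil M x x * x i) = y
  have hy0 : ∑ i, y i * r i = 0 := by
    rw [← hy]
    simp only [sub_mul, Finset.sum_sub_distrib]
    rw [← hbx]
    have : ∀ t : ℝ, ∑ j, t * x j * r j = t * bil M x x := by
      intro t; rw [hbx, Finset.mul_sum]; exact Finset.sum_congr rfl fun j _ => by ring
    rw [this, div_mul_cancel₀ _ hxxp.ne', sub_self]
  have hyN : bil M y y = bil N (fun i => s i * y i) (fun i => s i * y i) := by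
    unfold bil
    refine Finset.sum_congr rfl fun i _ => Finset.sum_congr rfl fun j _ => ?_
    rw [hNM]; ring
  rw [hyN, hq]
  refine Finset.sum_nonpos fun k _ => ?_
  rcases le_or_gt (l k) 0 with h | h
  · exact mul_nonpos_of_nonpos_of_nonneg h (sq_nonneg _)
  · obtain ⟨a, ha⟩ := hpos k h
    have : ∑ i, s i * y i * e k i = 0 := by
      have e1 : ∑ i, s i * y i * e k i = a * ∑ i, y i * r i := by
        rw [Finset.mul_sum]
        refine Finset.sum_congr rfl fun i _ => ?_
        rw [ha, ← hs2]; ring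
      rw [e1, hy0, mul_zero]
    rw [this]; simp

/-- The normalized coefficient `α! · [x^α] p`. -/
noncomputable def wt {q : ℕ} (p : MvPolynomial (Fin q) ℝ) (α : Fin q →₀ ℕ) : ℝ :=
  MvPolynomial.coeff α p * ∏ i, ((α i).factorial : ℝ)

/-- Polynomials whose normalized coefficients are M-concave. -/
structure MC {q : ℕ} (p : MvPolynomial (Fin q) ℝ) : Prop where
  nonneg : ∀ α, 0 ≤ wt p α
  exch : ∀ α β, 0 < wt p α → 0 < wt p β → ∀ i, β i < α i → ∃ j, α j < β j ∧
    wt p α * wt p β ≤ wt p (α + Finsupp.single j 1 - Finsupp.single i 1) *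
      wt p (β + Finsupp.single i 1 - Finsupp.single j 1)

lemma wt_pderiv {q : ℕ} (p : MvPolynomial (Fin q) ℝ) (i : Fin q) (α : Fin q →₀ ℕ) :
    wt (MvPolynomial.pderiv i p) α = wt p (α + Finsupp.single i 1) := by
  unfold wt
  rw [MvPolynomial.coeff_pderiv, mul_assoc]
  congr 1
  rw [← Finset.mul_prod_erase Finset.univ _ (Finset.mem_univ i),
    ← Finset.mul_prod_erase Finset.univ _ (Finset.mem_univ i), ← mul_assoc]
  congr 1
  · simp [Nat.factorial_succ]
  · refine Finset.prod_congr rfl fun j hj => ?_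
    have : i ≠ j := (Finset.ne_of_mem_erase hj).symm
    simp [this]

lemma MC.pderiv {q : ℕ} {p : MvPolynomial (Fin q) ℝ} (hp : MC p) (k : Fin q) :
    MC (MvPolynomial.pderiv k p) := by
  refine ⟨fun α => by rw [wt_pderiv]; exact hp.nonneg _, fun α β hα hβ i hi => ?_⟩
  simp only [wt_pderiv] at *
  obtain ⟨j, hj, h⟩ := hp.exch _ _ hα hβ i (by simpa using hi)
  have hj' : α j < β j := by simpa using hj
  refine ⟨j, hj', h.trans (le_of_eq ?_)⟩
  congr 2
  · ext a
    simp only [Finsupp.coe_add, Finsupp.coe_tsub, Pi.add_apply, Pi.sub_apply, Finsupp.single_apply]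
    by_cases h : i = a
    · subst h; simp only [if_true]; omega
    · simp only [h, if_false]; omega
  · ext a
    simp only [Finsupp.coe_add, Finsupp.coe_tsub, Pi.add_apply, Pi.sub_apply, Finsupp.single_apply]
    by_cases h : j = a
    · subst h; simp only [if_true]; omega
    · simp only [h, if_false]; omega

lemma pderiv_comm' {q : ℕ} (p : MvPolynomial (Fin q) ℝ) (i j : Fin q) :
    MvPolynomial.pderiv i (MvPolynomial.pderiv j p)
      = MvPolynomial.pderiv j (MvPolynomial.pderiv i p) := by
  by_cases h : i = j
  · rw [h]
  ext m
  simp only [MvPolynomial.coeff_pderiv]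
  rw [add_right_comm]
  simp [h, Ne.symm h]
  ring

lemma wt_pos_iff {q : ℕ} (p : MvPolynomial (Fin q) ℝ) (α : Fin q →₀ ℕ) :
    0 < wt p α ↔ 0 < MvPolynomial.coeff α p := by
  unfold wt
  have : 0 < ∏ i, ((α i).factorial : ℝ) := Finset.prod_pos fun i _ => by positivity
  exact mul_pos_iff_of_pos_right this

lemma MC.coeff_nonneg {q : ℕ} {p : MvPolynomial (Fin q) ℝ} (hp : MC p) (α : Fin q →₀ ℕ) :
    0 ≤ MvPolynomial.coeff α p := by
  have : 0 < ∏ i, ((α i).factorial : ℝ) := Finset.prod_pos fun i _ => by positivity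
  exact nonneg_of_mul_nonneg_left (hp.nonneg α) this

lemma MC.eval_nonneg {q : ℕ} {p : MvPolynomial (Fin q) ℝ} (hp : MC p) (x : Fin q → ℝ)
    (hx : ∀ i, 0 < x i) : 0 ≤ MvPolynomial.eval x p := by
  rw [MvPolynomial.eval_eq']
  exact Finset.sum_nonneg fun α _ => mul_nonneg (hp.coeff_nonneg α)
    (Finset.prod_nonneg fun i _ => pow_nonneg (hx i).le _)

lemma MC.eval_pos {q : ℕ} {p : MvPolynomial (Fin q) ℝ} (hp : MC p) (x : Fin q → ℝ)
    (hx : ∀ i, 0 < x i) (α : Fin q →₀ ℕ) (hα : 0 < wt p α) : 0 < MvPolynomial.eval x p := by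
  rw [wt_pos_iff] at hα
  rw [MvPolynomial.eval_eq']
  exact Finset.sum_pos' (fun α _ => mul_nonneg (hp.coeff_nonneg α)
    (Finset.prod_nonneg fun i _ => pow_nonneg (hx i).le _))
    ⟨α, MvPolynomial.mem_support_iff.2 hα.ne',
      mul_pos hα (Finset.prod_pos fun i _ => pow_pos (hx i) _)⟩

lemma MC.exists_wt {q : ℕ} {p : MvPolynomial (Fin q) ℝ} (hp : MC p) (x : Fin q → ℝ)
    (h : MvPolynomial.eval x p ≠ 0) : ∃ α, 0 < wt p α := by
  by_contra! hc
  apply h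
  have : p = 0 := by
    ext α
    have h1 := hc α
    rw [← not_lt, wt_pos_iff, not_lt] at h1
    simpa using le_antisymm h1 (hp.coeff_nonneg α)
  rw [this]; simp

lemma euler_eval {q n : ℕ} {p : MvPolynomial (Fin q) ℝ} (hp : p.IsHomogeneous n)
    (x : Fin q → ℝ) :
    ∑ i, x i * MvPolynomial.eval x (MvPolynomial.pderiv i p) = n * MvPolynomial.eval x p := by
  have := congrArg (MvPolynomial.eval x) hp.sum_X_mul_pderiv
  simpa using this

/-- Hessian at a point. -/
noncomputable def hess {q : ℕ} (p : MvPolynomial (Fin q) ℝ) (x : Fin q → ℝ) (i j : Fin q) : ℝ :=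
  MvPolynomial.eval x (MvPolynomial.pderiv i (MvPolynomial.pderiv j p))

lemma hess_symm {q : ℕ} (p : MvPolynomial (Fin q) ℝ) (x : Fin q → ℝ) (i j : Fin q) :
    hess p x i j = hess p x j i := by
  unfold hess; rw [pderiv_comm']

lemma hess_mul {q n : ℕ} {p : MvPolynomial (Fin q) ℝ} (hp : p.IsHomogeneous (n + 1))
    (x : Fin q → ℝ) (i : Fin q) :
    ∑ l, hess p x i l * x l = n * MvPolynomial.eval x (MvPolynomial.pderiv i p) := by
  have h : (MvPolynomial.pderiv i p).IsHomogeneous n := hp.pderiv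
  rw [← euler_eval h]
  refine Finset.sum_congr rfl fun l _ => ?_
  unfold hess
  rw [pderiv_comm' p i l, mul_comm]

lemma MC.conn {q n : ℕ} {p : MvPolynomial (Fin q) ℝ} (hp : MC p) (hh : p.IsHomogeneous (n + 2))
    (x : Fin q → ℝ) (hx : ∀ i, 0 < x i) (u : Fin q → ℝ)
    (hu : ∀ a b, 0 < hess p x a b → u a = u b) (i j : Fin q)
    (hi : MvPolynomial.eval x (MvPolynomial.pderiv i p) ≠ 0)
    (hj : MvPolynomial.eval x (MvPolynomial.pderiv j p) ≠ 0) : u i = u j := by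
  have edge : ∀ (γ : Fin q →₀ ℕ) a b,
      0 < wt p (γ + Finsupp.single a 1 + Finsupp.single b 1) → u a = u b := by
    intro γ a b h
    apply hu
    refine ((hp.pderiv b).pderiv a).eval_pos x hx γ ?_
    rwa [wt_pderiv, wt_pderiv]
  have edge' : ∀ (γ : Fin q →₀ ℕ) a b, 0 < wt p (γ + Finsupp.single a 1) → 0 < γ b →
      u b = u a := by
    intro γ a b h hb
    refine edge (γ - Finsupp.single b 1) b a ?_
    rwa [tsub_add_cancel_of_le]
    rw [Finsupp.single_le_iff]; exact hb
  obtain ⟨α, hα⟩ := (hp.pderiv i).exists_wt x hi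
  obtain ⟨β, hβ⟩ := (hp.pderiv j).exists_wt x hj
  rw [wt_pderiv] at hα hβ
  by_cases hij : i = j
  · rw [hij]
  by_cases hbi : 0 < β i
  · exact edge' β j i hβ hbi
  have hlt : (β + Finsupp.single j 1 : Fin q →₀ ℕ) i < (α + Finsupp.single i 1 : Fin q →₀ ℕ) i := by
    simp [Finsupp.single_apply, Ne.symm hij]; omega
  obtain ⟨k, hk, hle⟩ := hp.exch _ _ hα hβ i hlt
  have hpos := (mul_pos hα hβ).trans_le hle
  have e1 : α + Finsupp.single i 1 + Finsupp.single k 1 - Finsupp.single i 1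
      = α + Finsupp.single k 1 := by
    rw [add_right_comm, add_tsub_cancel_right]
  rw [e1] at hpos
  have h1 : 0 < wt p (α + Finsupp.single k 1) := by
    rcases (hp.nonneg (α + Finsupp.single k 1)).eq_or_lt with h | h
    · rw [← h, zero_mul] at hpos; exact absurd hpos (lt_irrefl _)
    · exact h
  have hα0 : α ≠ 0 := by
    rintro rfl
    rw [wt_pos_iff] at hα
    have := hh hα.ne'
    simp [Finsupp.weight_apply] at this
  obtain ⟨m, hm⟩ := Finsupp.ne_iff.1 hα0
  have hm' : 0 < α m := Nat.pos_of_ne_zero hm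
  have a1 : u m = u i := edge' α i m hα hm'
  have a2 : u m = u k := edge' α k m h1 hm'
  have a3 : u k = u j := by
    by_cases hkj : k = j
    · rw [hkj]
    · refine edge' β j k hβ ?_
      have : (β + Finsupp.single j 1 : Fin q →₀ ℕ) k = β k := by simp [Finsupp.single_apply, Ne.symm hkj]
      omega
  rw [← a1, a2, a3]

lemma hess_deg_two {q : ℕ} {p : MvPolynomial (Fin q) ℝ} (hh : p.IsHomogeneous 2)
    (x : Fin q → ℝ) (i j : Fin q) :
    hess p x i j = wt p (Finsupp.single i 1 + Finsupp.single j 1) := by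
  have h : (MvPolynomial.pderiv i (MvPolynomial.pderiv j p)).IsHomogeneous 0 :=
    (hh.pderiv (i := j)).pderiv (i := i)
  have h1 := wt_pderiv (MvPolynomial.pderiv j p) i 0
  rw [zero_add, wt_pderiv p] at h1
  rw [← h1]
  unfold hess wt
  have h2 := MvPolynomial.totalDegree_eq_zero_iff_eq_C.1 (Nat.le_zero.1 h.totalDegree_le)
  rw [h2]
  simp

lemma hr_deg_two {q : ℕ} {p : MvPolynomial (Fin q) ℝ} (hp : MC p) (hh : p.IsHomogeneous 2)
    (x : Fin q → ℝ) (hx : ∀ i, 0 < x i) (v : Fin q → ℝ) :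
    bil (hess p x) v v * bil (hess p x) x x ≤ (bil (hess p x) v x) ^ 2 := by
  refine four_point_hr _ (fun i j => ?_) (hess_symm p x) (fun i j k l => ?_) x hx v
  · rw [hess_deg_two hh]; exact hp.nonneg _
  · have h0 : ∀ i j, 0 ≤ hess p x i j := fun i j => by
      rw [hess_deg_two hh]; exact hp.nonneg _
    rcases (h0 i j).eq_or_lt with h1 | h1
    · rw [← h1, zero_mul]; exact le_max_of_le_left (mul_nonneg (h0 _ _) (h0 _ _))
    rcases (h0 k l).eq_or_lt with h2 | h2
    · rw [← h2, mul_zero]; exact le_max_of_le_left (mul_nonneg (h0 _ _) (h0 _ _))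
    by_cases hik : i = k
    · subst hik; refine le_max_of_le_right (le_of_eq ?_)
      rw [hess_symm p x j i]; ring
    by_cases hil : i = l
    · subst hil; refine le_max_of_le_left (le_of_eq ?_)
      rw [hess_symm p x j i, hess_symm p x k i]; ring
    simp only [hess_deg_two hh] at h1 h2 ⊢
    obtain ⟨m, hm, hle⟩ := hp.exch _ _ h1 h2 i (by
      simp [Finsupp.single_apply, Ne.symm hik, Ne.symm hil])
    have e1 : Finsupp.single i 1 + Finsupp.single j 1 + Finsupp.single m 1 - Finsupp.single i 1
        = (Finsupp.single j 1 + Finsupp.single m 1 : Fin q →₀ ℕ) := by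
      rw [add_assoc, add_tsub_cancel_left]
    rw [e1] at hle
    have hmkl : m = k ∨ m = l := by
      by_contra! hc
      simp [Finsupp.single_apply, Ne.symm hc.1, Ne.symm hc.2] at hm
    rcases hmkl with rfl | rfl
    · refine le_max_of_le_right (hle.trans (le_of_eq ?_))
      rw [add_assoc, add_tsub_cancel_left, add_comm (Finsupp.single l 1), mul_comm]
    · refine le_max_of_le_left (hle.trans (le_of_eq ?_))
      rw [add_right_comm, add_tsub_cancel_right, add_comm (Finsupp.single k 1), mul_comm]

lemma hr_poly {q : ℕ} (n : ℕ) : ∀ (p : MvPolynomial (Fin q) ℝ), MC p → p.IsHomogeneous (n + 2) →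
    ∀ (x : Fin q → ℝ), (∀ i, 0 < x i) → ∀ v : Fin q → ℝ,
    bil (hess p x) v v * bil (hess p x) x x ≤ (bil (hess p x) v x) ^ 2 := by
  induction n with
  | zero => intro p hp hh x hx v; exact hr_deg_two hp hh x hx v
  | succ n ih =>
    intro p hp hh x hx v
    refine hr_step (hess p x) (fun k => hess (MvPolynomial.pderiv k p) x) x ((n + 1 : ℕ) : ℝ) hx
      (fun i j => ((hp.pderiv j).pderiv i).eval_nonneg x hx) (hess_symm p x) (by positivity)
      (fun k i j => (((hp.pderiv k).pderiv j).pderiv i).eval_nonneg x hx) ?_ ?_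
      (fun k v => ih _ (hp.pderiv k) hh.pderiv x hx v) ?_ v
    · intro i j
      have h : (MvPolynomial.pderiv i (MvPolynomial.pderiv j p)).IsHomogeneous (n + 1) :=
        (hh.pderiv (i := j)).pderiv (i := i)
      have := euler_eval h x
      unfold hess
      rw [← this]
      refine Finset.sum_congr rfl fun k _ => ?_
      rw [pderiv_comm' p j k, pderiv_comm' _ i k]
    · intro k i
      have h : (MvPolynomial.pderiv k p).IsHomogeneous (n + 1 + 1) := hh.pderiv (i := k)
      have := hess_mul h x i
      rw [this, hess_symm p x k i]
      rfl
    · intro u hu i j hi hj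
      rw [hess_mul (n := n + 2) hh] at hi hj
      exact hp.conn (n := n + 1) hh x hx u hu i j (right_ne_zero_of_mul hi.ne')
        (right_ne_zero_of_mul hj.ne')

/-- The log-concavity quadratic form is nonpositive on the open orthant. -/
lemma logconc_pos {q d : ℕ} (p : MvPolynomial (Fin q) ℝ) (hp : MC p) (hh : p.IsHomogeneous d)
    (x : Fin q → ℝ) (hx : ∀ i, 0 < x i) (v : Fin q → ℝ) :
    MvPolynomial.eval x p * bil (hess p x) v v
      ≤ (∑ i, v i * MvPolynomial.eval x (MvPolynomial.pderiv i p)) ^ 2 := by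
  by_cases hd : d < 2
  · have hz : ∀ i j, hess p x i j = 0 := by
      intro i j
      have h : (MvPolynomial.pderiv j p).IsHomogeneous 0 := by
        have := hh.pderiv (i := j)
        rwa [show d - 1 = 0 by omega] at this
      have h2 := MvPolynomial.totalDegree_eq_zero_iff_eq_C.1 (Nat.le_zero.1 h.totalDegree_le)
      unfold hess
      rw [h2]; simp
    have : bil (hess p x) v v = 0 := by simp [bil, hz]
    rw [this, mul_zero]; positivity
  obtain ⟨n, rfl⟩ : ∃ n, d = n + 2 := ⟨d - 2, by omega⟩
  have h := hr_poly n p hp hh x hx v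
  have b : ∀ y, bil (hess p x) y x
      = (n + 1 : ℕ) * ∑ i, y i * MvPolynomial.eval x (MvPolynomial.pderiv i p) := by
    intro y
    unfold bil
    rw [Finset.mul_sum]
    refine Finset.sum_congr rfl fun i _ => ?_
    have := hess_mul (n := n + 1) hh x i
    calc ∑ j, y i * hess p x i j * x j = y i * ∑ j, hess p x i j * x j := by
          rw [Finset.mul_sum]; exact Finset.sum_congr rfl fun j _ => by ring
      _ = _ := by rw [this]; ring
  rw [b, b, euler_eval hh] at h
  push_cast at h
  obtain ⟨G, hG⟩ : ∃ G, G = ∑ i, v i * MvPolynomial.eval x (MvPolynomial.pderiv i p) := ⟨_, rfl⟩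
  rw [← hG] at h ⊢
  obtain ⟨B, hB⟩ : ∃ B, B = MvPolynomial.eval x p * bil (hess p x) v v := ⟨_, rfl⟩
  have h' : ((n:ℝ) + 1) * (((n:ℝ) + 2) * B) ≤ ((n:ℝ) + 1) * (((n:ℝ) + 1) * G ^ 2) := by
    rw [hB]; linarith
  have h2 := le_of_mul_le_mul_left h' (by positivity)
  rw [← hB]
  have h3 : ((n:ℝ) + 2) * B ≤ ((n:ℝ) + 2) * G ^ 2 := by nlinarith [sq_nonneg G]
  exact le_of_mul_le_mul_left h3 (by positivity)

lemma logconc_nonneg {q d : ℕ} (p : MvPolynomial (Fin q) ℝ) (hp : MC p) (hh : p.IsHomogeneous d)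
    (x : Fin q → ℝ) (hx : ∀ i, 0 ≤ x i) (v : Fin q → ℝ) :
    MvPolynomial.eval x p * bil (hess p x) v v
      ≤ (∑ i, v i * MvPolynomial.eval x (MvPolynomial.pderiv i p)) ^ 2 := by
  have hc : ∀ r : MvPolynomial (Fin q) ℝ,
      Continuous (fun t : ℝ => MvPolynomial.eval (fun i => x i + t) r) := by
    intro r
    exact (MvPolynomial.continuous_eval r).comp (by fun_prop)
  let F : ℝ → ℝ := fun t => MvPolynomial.eval (fun i => x i + t) p *
    bil (hess p (fun i => x i + t)) v v
      - (∑ i, v i * MvPolynomial.eval (fun i => x i + t) (MvPolynomial.pderiv i p)) ^ 2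
  have hF : Continuous F := by
    refine Continuous.sub ((hc p).mul ?_) (Continuous.pow ?_ 2)
    · unfold bil hess
      exact continuous_finsetSum _ fun i _ => continuous_finsetSum _ fun j _ =>
        (continuous_const.mul (hc _)).mul continuous_const
    · exact continuous_finsetSum _ fun i _ => continuous_const.mul (hc _)
  have h1 : Filter.Tendsto F (nhdsWithin 0 (Set.Ioi 0)) (nhds (F 0)) :=
    (hF.tendsto 0).mono_left nhdsWithin_le_nhds
  have h2 : F 0 ≤ 0 := by
    refine le_of_tendsto h1 ?_
    filter_upwards [self_mem_nhdsWithin] with t ht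
    have := logconc_pos p hp hh (fun i => x i + t)
      (fun i => add_pos_of_nonneg_of_pos (hx i) ht) v
    simp only [F]; linarith
  simp only [F, add_zero] at h2
  linarith

lemma pderivMulti_good {q : ℕ} (β : Fin q → ℕ) (p : MvPolynomial (Fin q) ℝ) (hp : MC p)
    (hh : ∃ d, p.IsHomogeneous d) :
    MC (pderivMulti β p) ∧ ∃ d, (pderivMulti β p).IsHomogeneous d := by
  have it : ∀ (i : Fin q) (n : ℕ) (r : MvPolynomial (Fin q) ℝ),
      (MC r ∧ ∃ d, r.IsHomogeneous d) →
      (MC ((fun r => MvPolynomial.pderiv i r)^[n] r) ∧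
        ∃ d, ((fun r => MvPolynomial.pderiv i r)^[n] r).IsHomogeneous d) := by
    intro i n
    induction n with
    | zero => intro r h; exact h
    | succ n ih =>
      intro r h
      rw [Function.iterate_succ_apply]
      obtain ⟨h1, d, h2⟩ := h
      exact ih _ ⟨h1.pderiv i, d - 1, h2.pderiv⟩
  unfold pderivMulti
  induction (List.finRange q) with
  | nil => exact ⟨hp, hh⟩
  | cons a t ih => exact it a (β a) _ ih

/-- let `K = {α ∈ ℕ^q : α ≤ κ}` and let `w : K → ℝ≥0` be `d`-homogeneous
(`w(α) > 0 ⟹ Σ_i α_i = d`) and satisfy the multiplicative exchange property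
(`log w` is M-concave). Then `g(x) = Σ_{α ∈ K} (w(α)/α!)·x^α` is strongly log-concave. -/
theorem slc_of_M_concave_weights {q : ℕ} (κ : Fin q → ℕ) (d : ℕ)
    (w : (Fin q → ℕ) → ℝ)
    (hw0 : ∀ α : Fin q → ℕ, (∀ i, α i ≤ κ i) → 0 ≤ w α)
    (hhom : ∀ α : Fin q → ℕ, (∀ i, α i ≤ κ i) → 0 < w α → (∑ i, α i) = d)
    (hexch : ∀ α β : Fin q → ℕ, (∀ i, α i ≤ κ i) → (∀ i, β i ≤ κ i) →
      0 < w α → 0 < w β → ∀ i : Fin q, β i < α i →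
        ∃ j : Fin q, α j < β j ∧
          w α * w β ≤ w (exchangeMove α i j) * w (exchangeMove β j i)) :
    StronglyLogConcave
      (∑ α ∈ Fintype.piFinset (fun i => Finset.range (κ i + 1)),
        MvPolynomial.monomial (Finsupp.equivFunOnFinite.symm α)
          (w α / (∏ i, Nat.factorial (α i) : ℕ))) := by
  classical
  set g := (∑ α ∈ Fintype.piFinset (fun i => Finset.range (κ i + 1)),
        MvPolynomial.monomial (Finsupp.equivFunOnFinite.symm α)
          (w α / (∏ i, Nat.factorial (α i) : ℕ))) with hg
  have hcoeff : ∀ α : Fin q →₀ ℕ, MvPolynomial.coeff α g =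
      if (∀ i, α i ≤ κ i) then w α / (∏ i, Nat.factorial (α i) : ℕ) else 0 := by
    intro α
    rw [hg, MvPolynomial.coeff_sum]
    simp only [MvPolynomial.coeff_monomial]
    have : ∀ a : Fin q → ℕ, (Finsupp.equivFunOnFinite.symm a = α) ↔ a = ⇑α := by
      intro a
      rw [Equiv.symm_apply_eq]; rfl
    simp only [this]
    rw [Finset.sum_ite_eq']
    simp only [Fintype.mem_piFinset, Finset.mem_range, Nat.lt_succ_iff]
  have hwt : ∀ α : Fin q →₀ ℕ, wt g α = if (∀ i, α i ≤ κ i) then w α else 0 := by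
    intro α
    unfold wt
    rw [hcoeff]
    split_ifs
    · push_cast
      refine div_mul_cancel₀ _ (Finset.prod_ne_zero_iff.2 fun i _ => ?_)
      positivity
    · simp
  have hMC : MC g := by
    refine ⟨fun α => ?_, fun α β hα hβ i hi => ?_⟩
    · rw [hwt]; split_ifs with h
      · exact hw0 _ h
      · exact le_rfl
    · have hαK : ∀ i, α i ≤ κ i := by
        by_contra h; rw [hwt, if_neg h] at hα; exact lt_irrefl _ hα
      have hβK : ∀ i, β i ≤ κ i := by
        by_contra h; rw [hwt, if_neg h] at hβ; exact lt_irrefl _ hβ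
      rw [hwt, if_pos hαK] at hα
      rw [hwt, if_pos hβK] at hβ
      obtain ⟨j, hj, hle⟩ := hexch α β hαK hβK hα hβ i hi
      refine ⟨j, hj, ?_⟩
      have e1 : ⇑(α + Finsupp.single j 1 - Finsupp.single i 1 : Fin q →₀ ℕ) = exchangeMove α i j := by
        ext l
        simp [exchangeMove, Finsupp.single_apply, eq_comm]
      have e2 : ⇑(β + Finsupp.single i 1 - Finsupp.single j 1 : Fin q →₀ ℕ) = exchangeMove β j i := by
        ext l
        simp [exchangeMove, Finsupp.single_apply, eq_comm]
      have k1 : ∀ l, exchangeMove α i j l ≤ κ l := by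
        intro l
        have := hαK l
        have := hβK l
        unfold exchangeMove
        by_cases h : l = j
        · subst h; simp only [if_true]; omega
        · simp only [h, if_false]; omega
      have k2 : ∀ l, exchangeMove β j i l ≤ κ l := by
        intro l
        have := hαK l
        have := hβK l
        unfold exchangeMove
        by_cases h : l = i
        · subst h; simp only [if_true]; omega
        · simp only [h, if_false]; omega
      rw [hwt, hwt, hwt, hwt, e1, e2, if_pos hαK, if_pos hβK, if_pos k1, if_pos k2]
      exact hle
  have hhomog : g.IsHomogeneous d := by
    intro α hα
    have h1 : 0 < wt g α := by
      rw [wt_pos_iff]; exact lt_of_le_of_ne (hMC.coeff_nonneg α) (Ne.symm hα)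
    have hαK : ∀ i, α i ≤ κ i := by
      by_contra h; rw [hwt, if_neg h] at h1; exact lt_irrefl _ h1
    rw [hwt, if_pos hαK] at h1
    rw [← hhom α hαK h1, Finsupp.weight_apply, Finsupp.sum_fintype _ _ (by simp)]
    simp
  intro β x hx _
  obtain ⟨h1, d', h2⟩ := pderivMulti_good β g hMC ⟨d, hhomog⟩
  generalize pderivMulti β g = p at h1 h2
  refine Matrix.PosSemidef.of_dotProduct_mulVec_nonneg ?_ fun v => ?_
  · ext i j
    simp only [Matrix.conjTranspose_apply, Matrix.neg_apply, Matrix.of_apply, star_trivial]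
    rw [pderiv_comm' p j i]; ring
  · have h := logconc_nonneg p h1 h2 x hx v
    have e : star v ⬝ᵥ (-(Matrix.of fun i j : Fin q =>
        MvPolynomial.eval x p
            * MvPolynomial.eval x (MvPolynomial.pderiv i (MvPolynomial.pderiv j p))
          - MvPolynomial.eval x (MvPolynomial.pderiv i p)
            * MvPolynomial.eval x (MvPolynomial.pderiv j p))).mulVec v
        = (∑ i, v i * MvPolynomial.eval x (MvPolynomial.pderiv i p)) ^ 2
          - MvPolynomial.eval x p * bil (hess p x) v v := by
      rw [sq, Finset.sum_mul_sum]
      unfold bil hess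
      simp only [Finset.mul_sum, ← Finset.sum_sub_distrib, dotProduct, Matrix.mulVec,
        Matrix.neg_apply, Matrix.of_apply, star_trivial]
      refine Finset.sum_congr rfl fun i _ => Finset.sum_congr rfl fun j _ => ?_
      ring
    rw [e]; linarith
end

section
/- Let n, q ∈ ℕ with q ≥ 1, let T ≥ 0, let L = {α ∈ ℕ^q : Σ_{p=1}^q α_p = n}, and let Φ : L → ℝ be M-convex. Then the n-homogeneous generating polynomial g(x₁,…,x_q) = Σ_{α ∈ L} (n!/α!)·e^{−T·Φ(α)}·x^α, where α! = Π_p α_p! and x^α = Π_p x_p^{α_p}, is strongly log-concave. (In the paper, Φ is Rosenthal's potential of an extension parallel congestion game viewed as a function of strategy load profiles, which is M-convex by a result of Fujishige et al.; n!/α! is the number of strategy profiles with strategy load profile α.) -/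
open Finset MvPolynomial

/-- The set `L = {α ∈ ℕ^q : Σ_p α_p = n}` of strategy load profiles of `n` players
over `q` strategies. -/
def loadProfiles (n q : ℕ) : Finset (Fin q → ℕ) :=
  (Fintype.piFinset fun _ : Fin q => Finset.range (n + 1)).filter fun α => (∑ p, α p) = n


theorem rel_psd {ι : Type*} [Fintype ι] [DecidableEq ι] (R : ι → ι → Prop) [DecidableRel R]
    (hs : ∀ i j, R i j → R j i) (ht : ∀ i j k, R i j → R j k → R i k) (v : ι → ℝ) :
    0 ≤ ∑ i, ∑ j, (if R i j then (1:ℝ) else 0) * (v i * v j) := by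
  let f : ι → Finset ι := fun i => univ.filter (R i)
  have key : ∀ i j, (if R i j then (1:ℝ) else 0) =
      ∑ s : Finset ι, (if (f i = s ∧ R i i) then (1:ℝ) else 0) * (if (f j = s ∧ R j j) then (1:ℝ) else 0) := by
    intro i j
    rw [Finset.sum_eq_single (f i)]
    · by_cases h : R i j
      · have h1 : R i i := ht _ _ _ h (hs _ _ h)
        have h2 : R j j := ht _ _ _ (hs _ _ h) h
        have h3 : f j = f i := by
          ext k; simp only [f, mem_filter, mem_univ, true_and]
          exact ⟨fun a => ht _ _ _ h a, fun a => ht _ _ _ (hs _ _ h) a⟩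
        simp [h, h1, h2, h3]
      · have : ¬ ((f j = f i ∧ R j j) ) := by
          rintro ⟨h3, h2⟩
          have : j ∈ f j := by simp [f, h2]
          rw [h3] at this
          simp [f] at this
          exact h this
        simp [h, this]
    · intro s _ hs
      simp [Ne.symm hs]
    · simp
  have : ∑ i, ∑ j, (if R i j then (1:ℝ) else 0) * (v i * v j) =
      ∑ s : Finset ι, (∑ i, (if (f i = s ∧ R i i) then (1:ℝ) else 0) * v i)^2 := by
    simp_rw [key, sq, Finset.sum_mul_sum, Finset.sum_mul]
    rw [Finset.sum_comm' (t' := univ) (s' := fun _ => univ) (by simp)]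
    rw [Finset.sum_comm]
    conv_rhs => rw [Finset.sum_comm]
    refine Finset.sum_congr rfl fun i _ => ?_
    conv_rhs => rw [Finset.sum_comm]
    rw [Finset.sum_comm]
    conv_rhs => rw [Finset.sum_comm]
    refine Finset.sum_congr rfl fun j _ => ?_
    refine Finset.sum_congr rfl fun s _ => ?_
    ring
  rw [this]
  positivity

theorem ultra_psd {ι : Type*} [Fintype ι] [DecidableEq ι] (v : ι → ℝ) (m : ℕ) :
    ∀ C : ι → ι → ℝ, (∀ i j, C i j = C j i) → (∀ i j, 0 ≤ C i j) →
    (∀ i j k, min (C i k) (C k j) ≤ C i j) →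
    (univ.filter (fun p : ι × ι => 0 < C p.1 p.2)).card = m →
    0 ≤ ∑ i, ∑ j, C i j * (v i * v j) := by
  induction m using Nat.strong_induction_on with
  | _ m ih =>
    intro C hs hn hu hc
    by_cases he : (univ.filter (fun p : ι × ι => 0 < C p.1 p.2)).Nonempty
    · obtain ⟨p, hp, hmin⟩ := Finset.exists_min_image _ (fun p : ι × ι => C p.1 p.2) he
      simp only [mem_filter, mem_univ, true_and] at hp hmin
      set t := C p.1 p.2 with htdef
      have hf : ∀ a b : ι, 0 < C a b → t ≤ C a b := fun a b h => hmin (a, b) h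
      let C' : ι → ι → ℝ := fun i j => max (C i j - t) 0
      have hdec : ∀ i j, C i j = t * (if 0 < C i j then 1 else 0) + C' i j := by
        intro i j
        by_cases h : 0 < C i j
        · have := hf _ _ h
          simp only [C', h, if_true]
          rw [max_eq_left (by linarith)]; ring
        · have h0 : C i j = 0 := le_antisymm (not_lt.mp h) (hn _ _)
          simp only [C', h0]
          rw [max_eq_right (by linarith)]; simp
      have h1 := rel_psd (fun i j => 0 < C i j) (fun i j h => by rw [hs j i]; exact h)
        (fun i j k h h' => lt_of_lt_of_le (lt_min h h') (hu i k j)) v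
      have h2 : 0 ≤ ∑ i, ∑ j, C' i j * (v i * v j) := by
        refine ih _ ?_ C' (fun i j => by simp only [C', hs i j]) (fun i j => le_max_right _ _) ?_ rfl
        · rw [← hc]
          apply Finset.card_lt_card
          rw [Finset.ssubset_iff_of_subset]
          · refine ⟨p, by simpa using hp, ?_⟩
            simp [C', htdef]
          · intro r hr
            simp only [mem_filter, mem_univ, true_and, C', lt_max_iff, lt_irrefl, or_false] at hr ⊢
            linarith
        · intro i j k
          simp only [C']
          have := hu i j k
          rcases min_le_iff.mp this with h | h
          · exact (min_le_left _ _).trans (max_le_max (by linarith) le_rfl)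
          · exact (min_le_right _ _).trans (max_le_max (by linarith) le_rfl)
      have : ∑ i, ∑ j, C i j * (v i * v j) =
          t * ∑ i, ∑ j, (if 0 < C i j then (1:ℝ) else 0) * (v i * v j) +
          ∑ i, ∑ j, C' i j * (v i * v j) := by
        simp_rw [Finset.mul_sum, ← Finset.sum_add_distrib]
        refine Finset.sum_congr rfl fun i _ => Finset.sum_congr rfl fun j _ => ?_
        conv_lhs => rw [hdec i j]
        ring
      rw [this]
      exact add_nonneg (mul_nonneg hp.le h1) h2
    · have h0 : ∀ i j, C i j = 0 := by
        intro i j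
        by_contra h
        exact he ⟨(i, j), by simpa using lt_of_le_of_ne (hn i j) (Ne.symm h)⟩
      simp [h0]

theorem gen_eig {ι : Type*} [Fintype ι] [DecidableEq ι] (A : ι → ι → ℝ) (hs : ∀ i j, A i j = A j i)
    (r : ι → ℝ) (hr : ∀ i, 0 < r i) :
    ∃ (l : ι → ℝ) (z : ι → ι → ℝ), (∀ k i, ∑ j, A i j * z k j = l k * (r i * z k i)) ∧
      (∀ k, ∑ i, r i * z k i ^ 2 = 1) ∧
      ∀ y : ι → ℝ, ∑ i, ∑ j, A i j * (y i * y j) = ∑ k, l k * (∑ i, r i * z k i * y i) ^ 2 := by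
  let s : ι → ℝ := fun i => Real.sqrt (r i)
  have hs0 : ∀ i, s i ≠ 0 := fun i => (Real.sqrt_pos.mpr (hr i)).ne'
  have hss : ∀ i, s i * s i = r i := fun i => Real.mul_self_sqrt (hr i).le
  let M : Matrix ι ι ℝ := Matrix.of fun i j => A i j / (s i * s j)
  have hM : M.IsHermitian := by
    ext i j
    simp [M, hs i j, mul_comm]
  let b := hM.eigenvectorBasis
  let l := hM.eigenvalues
  have hmul : ∀ (w : EuclideanSpace ℝ ι) i, ∑ j, A i j * (w j / s j) = s i * (M.mulVec w.ofLp) i := by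
    intro w i
    simp only [Matrix.mulVec, dotProduct, M, Matrix.of_apply, Finset.mul_sum]
    refine Finset.sum_congr rfl fun j _ => ?_
    have := hs0 i; have := hs0 j
    field_simp
  have heig : ∀ k i, (M.mulVec (b k).ofLp) i = l k * (b k) i := by
    intro k i
    have := hM.mulVec_eigenvectorBasis k
    exact congrFun this i
  refine ⟨l, fun k i => b k i / s i, ?_, ?_, ?_⟩
  · intro k i
    simp only
    rw [hmul, heig]
    rw [← hss]; have := hs0 i
    field_simp
  · intro k
    have h1 : ‖b k‖ ^ 2 = 1 := by rw [b.norm_eq_one]; norm_num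
    rw [EuclideanSpace.norm_sq_eq] at h1
    rw [← h1]
    refine Finset.sum_congr rfl fun i _ => ?_
    rw [← hss]; have := hs0 i
    simp only [Real.norm_eq_abs, sq_abs]
    field_simp
  · intro y
    let w : EuclideanSpace ℝ ι := WithLp.toLp 2 fun i => s i * y i
    have hc : ∀ k, ∑ i, r i * (b k i / s i) * y i = inner ℝ (b k) w := by
      intro k
      simp only [PiLp.inner_apply, w]
      refine Finset.sum_congr rfl fun i _ => ?_
      rw [← hss]; have := hs0 i
      simp
      field_simp
    have hy : ∀ i, y i = ∑ k, inner ℝ (b k) w * (b k i / s i) := by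
      intro i
      have h := congrArg (fun u : EuclideanSpace ℝ ι => u i) (b.sum_repr' w)
      simp [w] at h
      have h0 := hs0 i
      have : y i = (s i * y i) / s i := by field_simp
      rw [this, ← h, Finset.sum_div]
      refine Finset.sum_congr rfl fun k _ => ?_
      simp [w]
      ring
    have hAy : ∀ i, ∑ j, A i j * y j = ∑ k, inner ℝ (b k) w * (l k * (s i * b k i)) := by
      intro i
      calc ∑ j, A i j * y j = ∑ j, ∑ k, inner ℝ (b k) w * (A i j * (b k j / s j)) := by
            refine Finset.sum_congr rfl fun j _ => ?_
            rw [hy j, Finset.mul_sum]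
            refine Finset.sum_congr rfl fun k _ => by ring
        _ = _ := by
            rw [Finset.sum_comm]
            refine Finset.sum_congr rfl fun k _ => ?_
            rw [← Finset.mul_sum, hmul, heig]; ring
    calc ∑ i, ∑ j, A i j * (y i * y j) = ∑ i, y i * ∑ j, A i j * y j := by
          refine Finset.sum_congr rfl fun i _ => ?_
          rw [Finset.mul_sum]
          refine Finset.sum_congr rfl fun j _ => by ring
      _ = ∑ i, ∑ k, (l k * inner ℝ (b k) w) * (r i * (b k i / s i) * y i) := by
          refine Finset.sum_congr rfl fun i _ => ?_
          rw [hAy, Finset.mul_sum]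
          refine Finset.sum_congr rfl fun k _ => ?_
          rw [← hss]; have := hs0 i
          field_simp
      _ = _ := by
          rw [Finset.sum_comm]
          refine Finset.sum_congr rfl fun k _ => ?_
          rw [← Finset.mul_sum, hc]; ring

/-- The bilinear form of a matrix of reals. -/
def bilF {ι : Type*} [Fintype ι] (H : ι → ι → ℝ) (x y : ι → ℝ) : ℝ :=
  ∑ i, ∑ j, H i j * (x i * y j)

theorem bilF_symm {ι : Type*} [Fintype ι] (H : ι → ι → ℝ) (hs : ∀ i j, H i j = H j i)
    (x y : ι → ℝ) : bilF H x y = bilF H y x := by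
  unfold bilF
  rw [Finset.sum_comm]
  refine Finset.sum_congr rfl fun i _ => Finset.sum_congr rfl fun j _ => ?_
  rw [hs j i]; ring

theorem bilF_sub {ι : Type*} [Fintype ι] (H : ι → ι → ℝ) (hs : ∀ i j, H i j = H j i)
    (x y : ι → ℝ) (t : ℝ) : bilF H (fun i => y i - t * x i) (fun i => y i - t * x i) =
      bilF H y y - 2 * t * bilF H x y + t ^ 2 * bilF H x x := by
  have : bilF H (fun i => y i - t * x i) (fun i => y i - t * x i) =
      bilF H y y - t * bilF H x y - t * bilF H y x + t ^ 2 * bilF H x x := by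
    unfold bilF
    simp_rw [Finset.mul_sum, ← Finset.sum_sub_distrib, ← Finset.sum_add_distrib]
    refine Finset.sum_congr rfl fun i _ => Finset.sum_congr rfl fun j _ => ?_
    ring
  rw [this, bilF_symm H hs y x]; ring

theorem rev_cs {ι : Type*} [Fintype ι] (H : ι → ι → ℝ) (hs : ∀ i j, H i j = H j i)
    (l : ι → ℝ) (hneg : ∀ z : ι → ℝ, ∑ i, l i * z i = 0 → bilF H z z ≤ 0)
    (x : ι → ℝ) (hx : 0 < bilF H x x) (y : ι → ℝ) :
    bilF H x x * bilF H y y ≤ bilF H x y ^ 2 := by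
  have hl : ∑ i, l i * x i ≠ 0 := fun h => absurd (hneg x h) (not_le.mpr hx)
  set t := (∑ i, l i * y i) / (∑ i, l i * x i) with ht
  have h0 := hneg (fun i => y i - t * x i) (by
    have : ∑ i, l i * (y i - t * x i) = ∑ i, l i * y i - t * ∑ i, l i * x i := by
      rw [Finset.mul_sum, ← Finset.sum_sub_distrib]
      refine Finset.sum_congr rfl fun i _ => by ring
    rw [this, ht]; field_simp; ring)
  rw [bilF_sub H hs] at h0
  have h1 := mul_le_mul_of_nonneg_left h0 hx.le
  nlinarith [sq_nonneg (bilF H x y - t * bilF H x x)]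

theorem lor_step {ι : Type*} [Fintype ι] [DecidableEq ι] (A : ι → ι → ℝ)
    (hs : ∀ i j, A i j = A j i) (hpos : ∀ i j, 0 < A i j)
    (h : ∀ z : ι → ℝ, bilF A z z ≤ ∑ i, (∑ j, A i j * z j) ^ 2 / (∑ j, A i j))
    (z : ι → ℝ) (hz : ∑ i, (∑ j, A i j) * z i = 0) : bilF A z z ≤ 0 := by
  have hr : ∀ i, 0 < ∑ j, A i j := fun i => Finset.sum_pos (fun j _ => hpos i j) ⟨i, mem_univ i⟩
  obtain ⟨l, e, h1, h2, h3⟩ := gen_eig A hs (fun i => ∑ j, A i j) hr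
  have hq : ∀ k, bilF A (e k) (e k) = l k := by
    intro k
    have : bilF A (e k) (e k) = ∑ i, e k i * ∑ j, A i j * e k j := by
      unfold bilF
      refine Finset.sum_congr rfl fun i _ => ?_
      rw [Finset.mul_sum]
      refine Finset.sum_congr rfl fun j _ => by ring
    rw [this]
    simp_rw [h1]
    conv_rhs => rw [← mul_one (l k), ← h2 k, Finset.mul_sum]
    refine Finset.sum_congr rfl fun i _ => by ring
  have hlap : ∀ y : ι → ℝ, ∑ i, ∑ j, A i j * (y i - y j) ^ 2 =
      2 * (∑ i, (∑ j, A i j) * y i ^ 2 - bilF A y y) := by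
    intro y
    have e1 : ∑ i, (∑ j, A i j) * y i ^ 2 = ∑ i, ∑ j, A i j * y i ^ 2 := by
      simp_rw [Finset.sum_mul]
    have e2 : ∑ i, (∑ j, A i j) * y i ^ 2 = ∑ i, ∑ j, A i j * y j ^ 2 := by
      rw [e1, Finset.sum_comm]
      refine Finset.sum_congr rfl fun i _ => Finset.sum_congr rfl fun j _ => by rw [hs]
    have : 2 * (∑ i, (∑ j, A i j) * y i ^ 2 - bilF A y y) =
      ∑ i, ∑ j, A i j * y i ^ 2 + ∑ i, ∑ j, A i j * y j ^ 2 - 2 * bilF A y y := by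
      rw [← e2, ← e1]; ring
    rw [this]
    unfold bilF
    simp_rw [Finset.mul_sum, ← Finset.sum_add_distrib, ← Finset.sum_sub_distrib]
    refine Finset.sum_congr rfl fun i _ => Finset.sum_congr rfl fun j _ => by ring
  have hk : ∀ k, l k ≤ 0 ∨ ∑ i, (∑ j, A i j) * e k i * z i = 0 := by
    intro k
    by_cases hl : l k ≤ 0
    · exact Or.inl hl
    right
    push Not at hl
    have a1 : l k ≤ l k ^ 2 := by
      have := h (e k)
      rw [hq] at this
      refine this.trans (le_of_eq ?_)
      rw [← mul_one (l k ^ 2), ← h2 k, Finset.mul_sum]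
      refine Finset.sum_congr rfl fun i _ => ?_
      rw [h1]
      have := (hr i).ne'
      field_simp
    have a2 : 1 ≤ l k := by nlinarith
    have a3 := hlap (e k)
    rw [h2, hq] at a3
    have nn : ∀ i j, 0 ≤ A i j * (e k i - e k j) ^ 2 :=
      fun i j => mul_nonneg (hpos i j).le (sq_nonneg _)
    have a4 : ∑ i, ∑ j, A i j * (e k i - e k j) ^ 2 = 0 := by
      apply le_antisymm
      · rw [a3]; linarith
      · exact Finset.sum_nonneg fun i _ => Finset.sum_nonneg fun j _ => nn i j
    have a5 : ∀ i j, e k i = e k j := by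
      intro i j
      have b1 := (Finset.sum_eq_zero_iff_of_nonneg
        (fun i _ => Finset.sum_nonneg fun j _ => nn i j)).mp a4 i (mem_univ i)
      have b2 := (Finset.sum_eq_zero_iff_of_nonneg (fun j _ => nn i j)).mp b1 j (mem_univ j)
      rcases mul_eq_zero.mp b2 with b | b
      · exact absurd b (hpos i j).ne'
      · exact sub_eq_zero.mp (pow_eq_zero_iff (two_ne_zero) |>.mp b)
    calc ∑ i, (∑ j, A i j) * e k i * z i = ∑ i, e k k * ((∑ j, A i j) * z i) :=
          Finset.sum_congr rfl fun i _ => by rw [a5 i k]; ring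
      _ = 0 := by rw [← Finset.mul_sum, hz, mul_zero]
  unfold bilF
  rw [h3]
  refine Finset.sum_nonpos fun k _ => ?_
  rcases hk k with h | h
  · exact mul_nonpos_of_nonpos_of_nonneg h (sq_nonneg _)
  · rw [h]; simp

theorem lor_step' {ι : Type*} [Fintype ι] [DecidableEq ι] [Nonempty ι] (H : ι → ι → ℝ)
    (hs : ∀ i j, H i j = H j i) (hpos : ∀ i j, 0 < H i j) (x : ι → ℝ) (hx : ∀ i, 0 < x i)
    (h : ∀ z : ι → ℝ, bilF H z z ≤ ∑ i, x i * ((∑ j, H i j * z j) ^ 2 / (∑ j, H i j * x j)))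
    (y : ι → ℝ) : bilF H x x * bilF H y y ≤ bilF H x y ^ 2 := by
  refine rev_cs H hs (fun i => ∑ j, H i j * x j) ?_ x ?_ y
  · intro y hy
    let A : ι → ι → ℝ := fun i j => x i * x j * H i j
    have hb : ∀ z : ι → ℝ, bilF A z z = bilF H (fun i => x i * z i) (fun i => x i * z i) := by
      intro z
      unfold bilF
      refine Finset.sum_congr rfl fun i _ => Finset.sum_congr rfl fun j _ => ?_
      simp only [A]; ring
    have hA : ∀ (z : ι → ℝ) i, ∑ j, A i j * z j = x i * ∑ j, H i j * (x j * z j) := by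
      intro z i
      rw [Finset.mul_sum]
      refine Finset.sum_congr rfl fun j _ => ?_
      simp only [A]; ring
    have hr : ∀ i, ∑ j, A i j = x i * ∑ j, H i j * x j := by
      intro i
      have := hA (fun _ => 1) i
      simpa using this
    have key := lor_step A (fun i j => by simp only [A, hs i j]; ring)
      (fun i j => mul_pos (mul_pos (hx i) (hx j)) (hpos i j)) ?_ (fun i => y i / x i) ?_
    · rw [hb] at key
      have : (fun i => x i * (y i / x i)) = y := by
        funext i; have := (hx i).ne'; field_simp
      rwa [this] at key
    · intro z
      rw [hb]
      refine (h _).trans (le_of_eq ?_)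
      refine Finset.sum_congr rfl fun i _ => ?_
      rw [hA, hr]
      have h1 := (hx i).ne'
      have h2 : ∑ j, H i j * x j ≠ 0 :=
        (Finset.sum_pos (fun j _ => mul_pos (hpos i j) (hx j)) ⟨i, mem_univ i⟩).ne'
      field_simp
    · rw [← hy]
      refine Finset.sum_congr rfl fun i _ => ?_
      rw [hr]
      have h1 := (hx i).ne'
      field_simp
  · exact Finset.sum_pos (fun i _ => Finset.sum_pos (fun j _ => mul_pos (hpos i j)
      (mul_pos (hx i) (hx j))) univ_nonempty) univ_nonempty

/-- Base case: the four point condition gives a Lorentzian quadratic form. -/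
theorem lor_base {ι : Type*} [Fintype ι] [DecidableEq ι] [Nonempty ι] (W : ι → ι → ℝ)
    (hs : ∀ i j, W i j = W j i) (hpos : ∀ i j, 0 < W i j)
    (h4 : ∀ i j k l, W i j * W k l ≤ max (W i k * W j l) (W i l * W j k))
    (x : ι → ℝ) (hx : ∀ i, 0 < x i) (y : ι → ℝ) :
    bilF W x x * bilF W y y ≤ bilF W x y ^ 2 := by
  obtain ⟨o⟩ := ‹Nonempty ι›
  refine rev_cs W hs (fun i => W o i) ?_ x ?_ y
  · intro z hz
    let B : ι → ι → ℝ := fun i j => W i j / (W o i * W o j)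
    let C : ι → ι → ℝ := fun i j => 1 / W o o - B i j
    have hu : ∀ i j k, B i j ≤ max (B i k) (B k j) := by
      intro i j k
      have p1 := hpos o i; have p2 := hpos o j; have p3 := hpos o k
      have := h4 i j k o
      rcases le_max_iff.mp this with h | h
      · refine le_max_of_le_left ?_
        simp only [B]
        rw [div_le_div_iff₀ (by positivity) (by positivity)]
        rw [hs k o, hs j o] at h
        nlinarith
      · refine le_max_of_le_right ?_
        simp only [B]
        rw [div_le_div_iff₀ (by positivity) (by positivity)]
        rw [hs k o, hs i o, hs j k] at h
        nlinarith
    have hBo : ∀ i, B i o = 1 / W o o := by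
      intro i
      have p1 := (hpos o i).ne'; have p2 := (hpos o o).ne'
      simp only [B, hs i o]; field_simp
    have hBs : ∀ i j, B i j = B j i := by
      intro i j; simp only [B, hs i j, mul_comm]
    have hC := ultra_psd (fun i => W o i * z i) _ C (fun i j => by simp only [C, hBs i j])
      (fun i j => by
        have := hu i j o
        rw [hBs o j, hBo, hBo, max_self] at this
        simp only [C]; linarith)
      (fun i j k => by
        rcases le_max_iff.mp (hu i j k) with h | h
        · exact (min_le_left _ _).trans (by simp only [C]; linarith)
        · exact (min_le_right _ _).trans (by simp only [C]; linarith)) rfl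
    have : ∑ i, ∑ j, C i j * (W o i * z i * (W o j * z j)) =
        1 / W o o * ((∑ i, W o i * z i) * (∑ i, W o i * z i)) - bilF W z z := by
      rw [Finset.sum_mul_sum]
      unfold bilF
      simp_rw [Finset.mul_sum, ← Finset.sum_sub_distrib]
      refine Finset.sum_congr rfl fun i _ => Finset.sum_congr rfl fun j _ => ?_
      have p1 := (hpos o i).ne'; have p2 := (hpos o j).ne'
      simp only [C, B]; field_simp
    rw [this, hz] at hC
    linarith
  · exact Finset.sum_pos (fun i _ => Finset.sum_pos (fun j _ => mul_pos (hpos i j)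
      (mul_pos (hx i) (hx j))) ⟨o, mem_univ o⟩) ⟨o, mem_univ o⟩

/-- Shift of a weight function by a unit vector. -/
def shW {q : ℕ} (i : Fin q) (w : (Fin q → ℕ) → ℝ) : (Fin q → ℕ) → ℝ :=
  fun γ => w (γ + Pi.single i 1)

theorem shW_comm {q : ℕ} (i j : Fin q) (w : (Fin q → ℕ) → ℝ) :
    shW i (shW j w) = shW j (shW i w) := by
  funext γ; simp only [shW]; congr 1; abel

/-- The generating function, by Euler's recursion. -/
def genF {q : ℕ} : ℕ → ((Fin q → ℕ) → ℝ) → (Fin q → ℝ) → ℝ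
  | 0, w, _ => w 0
  | d + 1, w, x => ∑ i, x i * genF d (shW i w) x

/-- Positive weights satisfying the local exchange condition. -/
def GoodW {q : ℕ} (d : ℕ) (w : (Fin q → ℕ) → ℝ) : Prop :=
  (∀ γ, 0 < w γ) ∧ ∀ μ : Fin q → ℕ, ∑ p, μ p + 2 = d → ∀ i j k l : Fin q,
    w (μ + Pi.single i 1 + Pi.single j 1) * w (μ + Pi.single k 1 + Pi.single l 1) ≤
    max (w (μ + Pi.single i 1 + Pi.single k 1) * w (μ + Pi.single j 1 + Pi.single l 1))
      (w (μ + Pi.single i 1 + Pi.single l 1) * w (μ + Pi.single j 1 + Pi.single k 1))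

theorem GoodW.shift {q d : ℕ} {w : (Fin q → ℕ) → ℝ} (h : GoodW (d + 1) w) (i : Fin q) :
    GoodW d (shW i w) := by
  refine ⟨fun γ => h.1 _, fun μ hμ a b c e => ?_⟩
  have := h.2 (μ + Pi.single i 1) (by
    simp [Finset.sum_add_distrib]; omega) a b c e
  have hc : ∀ s t : Fin q, μ + Pi.single s 1 + Pi.single t 1 + Pi.single i 1 =
    μ + Pi.single i 1 + Pi.single s 1 + Pi.single t 1 := fun s t => by abel
  simp only [shW, hc]
  exact this

theorem genF_pos {q : ℕ} [Nonempty (Fin q)] (d : ℕ) : ∀ (w : (Fin q → ℕ) → ℝ), (∀ γ, 0 < w γ) →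
    ∀ x : Fin q → ℝ, (∀ i, 0 < x i) → 0 < genF d w x := by
  induction d with
  | zero => intro w hw x hx; exact hw 0
  | succ d ih =>
    intro w hw x hx
    exact Finset.sum_pos (fun i _ => mul_pos (hx i) (ih _ (fun γ => hw _) x hx)) univ_nonempty

theorem lor_main {q : ℕ} [Nonempty (Fin q)] (d : ℕ) : ∀ (w : (Fin q → ℕ) → ℝ), GoodW (d + 2) w →
    ∀ x : Fin q → ℝ, (∀ i, 0 < x i) → ∀ y : Fin q → ℝ,
    bilF (fun i j => genF d (shW i (shW j w)) x) x x *
      bilF (fun i j => genF d (shW i (shW j w)) x) y y ≤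
      bilF (fun i j => genF d (shW i (shW j w)) x) x y ^ 2 := by
  induction d with
  | zero =>
    intro w hw x hx y
    refine lor_base (fun i j => genF 0 (shW i (shW j w)) x) (fun i j => by rw [shW_comm]) (fun i j => hw.1 _) ?_ x hx y
    intro i j k l
    simp only [genF, shW]
    have := hw.2 0 (by simp) i j k l
    simpa using this
  | succ d ih =>
    intro w hw x hx y
    refine lor_step' (fun i j => genF (d + 1) (shW i (shW j w)) x) (fun i j => by rw [shW_comm])
      (fun i j => genF_pos _ _ (fun γ => hw.1 _) x hx) x hx ?_ y
    intro z
    have e1 : bilF (fun i j => genF (d + 1) (shW i (shW j w)) x) z z =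
        ∑ a, x a * bilF (fun i j => genF d (shW i (shW j (shW a w))) x) z z := by
      unfold bilF
      simp only [genF, Finset.mul_sum, Finset.sum_mul]
      rw [Finset.sum_comm' (t' := univ) (s' := fun _ => univ) (by simp)]
      conv_rhs => rw [Finset.sum_comm]
      rw [Finset.sum_comm]
      refine Finset.sum_congr rfl fun i _ => ?_
      rw [Finset.sum_comm]
      refine Finset.sum_congr rfl fun a _ => Finset.sum_congr rfl fun j _ => ?_
      rw [shW_comm a i, shW_comm a j]
      ring
    have e2 : ∀ a (z : Fin q → ℝ), bilF (fun i j => genF d (shW i (shW j (shW a w))) x) x z =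
        ∑ j, genF (d + 1) (shW a (shW j w)) x * z j := by
      intro a z
      unfold bilF
      rw [Finset.sum_comm]
      refine Finset.sum_congr rfl fun j _ => ?_
      rw [shW_comm a j]
      simp only [genF, Finset.sum_mul]
      refine Finset.sum_congr rfl fun i _ => by ring
    rw [e1]
    refine Finset.sum_le_sum fun a _ => mul_le_mul_of_nonneg_left ?_ (hx a).le
    have := ih (shW a w) (hw.shift a) x hx z
    rw [e2, e2] at this
    have hp : 0 < ∑ j, genF (d + 1) (shW a (shW j w)) x * x j :=
      Finset.sum_pos (fun j _ => mul_pos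
        (genF_pos _ _ (fun γ => hw.1 _) x hx) (hx j)) univ_nonempty
    rw [le_div_iff₀ hp]
    linarith

theorem genF_cont {q : ℕ} (d : ℕ) : ∀ (w : (Fin q → ℕ) → ℝ), Continuous (genF d w) := by
  induction d with
  | zero => intro w; exact continuous_const
  | succ d ih =>
    intro w
    exact continuous_finsetSum _ fun i _ => (continuous_apply i).mul (ih _)

/-- The Lorentzian inequality on the closed orthant. -/
theorem lor_closed {q : ℕ} [Nonempty (Fin q)] (d : ℕ) (w : (Fin q → ℕ) → ℝ) (hw : GoodW (d + 2) w)
    (x : Fin q → ℝ) (hx : ∀ i, 0 ≤ x i) (y : Fin q → ℝ) :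
    genF (d + 2) w x * bilF (fun i j => genF d (shW i (shW j w)) x) y y ≤
      (∑ j, genF (d + 1) (shW j w) x * y j) ^ 2 := by
  have e2 : ∀ (x z : Fin q → ℝ), bilF (fun i j => genF d (shW i (shW j w)) x) x z =
        ∑ j, genF (d + 1) (shW j w) x * z j := by
    intro x z
    unfold bilF
    rw [Finset.sum_comm]
    refine Finset.sum_congr rfl fun j _ => ?_
    simp only [genF, Finset.sum_mul]
    refine Finset.sum_congr rfl fun i _ => by ring
  have e3 : ∀ x, genF (d + 2) w x = bilF (fun i j => genF d (shW i (shW j w)) x) x x := by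
    intro x
    rw [e2]
    change ∑ i, x i * genF (d + 1) (shW i w) x = _
    refine Finset.sum_congr rfl fun i _ => by ring
  let u : ℝ → Fin q → ℝ := fun ε i => x i + ε
  have hu : Continuous u := by fun_prop
  have c1 : Continuous fun ε => genF (d + 2) w (u ε) *
      bilF (fun i j => genF d (shW i (shW j w)) (u ε)) y y := by
    refine ((genF_cont _ _).comp hu).mul ?_
    unfold bilF
    exact continuous_finsetSum _ fun i _ => continuous_finsetSum _ fun j _ =>
      ((genF_cont _ _).comp hu).mul continuous_const
  have c2 : Continuous fun ε => (∑ j, genF (d + 1) (shW j w) (u ε) * y j) ^ 2 :=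
    (continuous_finsetSum _ fun j _ => ((genF_cont _ _).comp hu).mul continuous_const).pow 2
  have hlim := le_of_tendsto_of_tendsto
    ((c1.tendsto 0).mono_left (nhdsWithin_le_nhds (s := Set.Ioi 0)))
    ((c2.tendsto 0).mono_left (nhdsWithin_le_nhds (s := Set.Ioi 0)))
    (by
      filter_upwards [self_mem_nhdsWithin] with ε hε
      have := lor_main d w hw (u ε) (fun i => add_pos_of_nonneg_of_pos (hx i) hε) y
      rw [← e3, e2] at this
      exact this)
  have u0 : u 0 = x := by funext i; simp [u]
  simpa only [u0] using hlim

/-- The polynomial version of `genF`. -/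
noncomputable def genP {q : ℕ} : ℕ → ((Fin q → ℕ) → ℝ) → MvPolynomial (Fin q) ℝ
  | 0, w => C (w 0)
  | d + 1, w => ∑ i, X i * genP d (shW i w)

theorem eval_genP {q : ℕ} (d : ℕ) (x : Fin q → ℝ) : ∀ (w : (Fin q → ℕ) → ℝ),
    eval x (genP d w) = genF d w x := by
  induction d with
  | zero => intro w; simp [genP, genF]
  | succ d ih => intro w; simp [genP, genF, ih]

theorem pderiv_genP {q : ℕ} (k : Fin q) (d : ℕ) : ∀ (w : (Fin q → ℕ) → ℝ),
    pderiv k (genP (d + 1) w) = C ((d : ℝ) + 1) * genP d (shW k w) := by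
  induction d with
  | zero =>
    intro w
    simp [genP, pderiv_X, Pi.single_apply, Finset.sum_ite_eq]
  | succ d ih =>
    intro w
    rw [genP, map_sum]
    simp only [Derivation.leibniz, pderiv_X, ih, smul_eq_mul]
    rw [Finset.sum_add_distrib]
    have h1 : ∑ i, X i * (C ((d : ℝ) + 1) * genP d (shW k (shW i w))) =
        C ((d : ℝ) + 1) * genP (d + 1) (shW k w) := by
      rw [genP, Finset.mul_sum]
      refine Finset.sum_congr rfl fun i _ => ?_
      rw [shW_comm k i]; ring
    have h2 : ∑ i, genP (d + 1) (shW i w) * (Pi.single k 1 : Fin q → MvPolynomial (Fin q) ℝ) i =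
        genP (d + 1) (shW k w) := by
      simp [Pi.single_apply, Finset.sum_ite_eq]
    rw [h1, h2]
    push_cast
    simp only [C_add, C_1]
    ring

theorem coeff_genP {q : ℕ} (d : ℕ) : ∀ (w : (Fin q → ℕ) → ℝ) (γ : Fin q →₀ ℕ),
    coeff γ (genP d w) = if ∑ p, γ p = d then
      (Nat.factorial d : ℝ) / (∏ p, Nat.factorial (γ p) : ℕ) * w γ else 0 := by
  induction d with
  | zero =>
    intro w γ
    rw [genP, coeff_C]
    by_cases h : γ = 0
    · subst h; simp
    · have : ¬ ∑ p, γ p = 0 := by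
        intro h'
        apply h
        ext p
        exact (Finset.sum_eq_zero_iff.mp h') p (mem_univ p)
      simp [this, Ne.symm h]
  | succ d ih =>
    intro w γ
    rw [genP, coeff_sum]
    simp only [coeff_X_mul', ih]
    have key : ∀ i, (if i ∈ γ.support then
        (if ∑ p, (γ - Finsupp.single i 1 : Fin q →₀ ℕ) p = d then
          (Nat.factorial d : ℝ) / (∏ p, Nat.factorial ((γ - Finsupp.single i 1 : Fin q →₀ ℕ) p) : ℕ) *
            shW i w ⇑(γ - Finsupp.single i 1 : Fin q →₀ ℕ) else 0) else 0) =
        (if ∑ p, γ p = d + 1 then (Nat.factorial d : ℝ) / (∏ p, Nat.factorial (γ p) : ℕ) * w γ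
          else 0) * (γ i : ℝ) := by
      intro i
      by_cases hi : i ∈ γ.support
      · have hi0 : γ i ≠ 0 := Finsupp.mem_support_iff.mp hi
        obtain ⟨δ, hδ⟩ : ∃ δ : Fin q →₀ ℕ, γ = δ + Finsupp.single i 1 :=
          ⟨γ - Finsupp.single i 1, by
            ext p
            by_cases hp : p = i
            · subst hp; simp; omega
            · simp [Finsupp.single_apply, Ne.symm hp]⟩
        have hs : γ - Finsupp.single i 1 = δ := by rw [hδ]; simp
        rw [if_pos hi, hs]
        have hsum : ∑ p, γ p = ∑ p, δ p + 1 := by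
          rw [hδ]; simp [Finset.sum_add_distrib, Finsupp.single_apply]
        have hw : shW i w ⇑δ = w ⇑γ := by
          simp only [shW]; congr 1
          funext p; rw [hδ]
          simp [Finsupp.single_apply, Pi.single_apply, eq_comm]
        have hprod : ∏ p, Nat.factorial (γ p) = (∏ p, Nat.factorial (δ p)) * γ i := by
          rw [← Finset.mul_prod_erase _ _ (mem_univ i),
            ← Finset.mul_prod_erase univ (fun p => Nat.factorial (δ p)) (mem_univ i)]
          have : ∏ p ∈ univ.erase i, Nat.factorial (γ p) =
              ∏ p ∈ univ.erase i, Nat.factorial (δ p) := by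
            refine Finset.prod_congr rfl fun p hp => ?_
            have := Finset.ne_of_mem_erase hp
            rw [hδ]; simp [Finsupp.single_apply, Ne.symm this]
          rw [this]
          have : γ i = δ i + 1 := by rw [hδ]; simp
          rw [this, Nat.factorial_succ]; ring
        rw [hsum, hw, hprod]
        by_cases hd : ∑ p, δ p = d
        · rw [if_pos hd, if_pos (by omega)]
          have : (γ i : ℝ) ≠ 0 := by exact_mod_cast hi0
          have h2 : ((∏ p, Nat.factorial (δ p) : ℕ) : ℝ) ≠ 0 := by
            exact_mod_cast Finset.prod_ne_zero_iff.mpr fun p _ => Nat.factorial_ne_zero _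
          push_cast at h2 ⊢
          field_simp
        · rw [if_neg hd, if_neg (by omega)]; simp
      · rw [if_neg hi]
        have : γ i = 0 := by simpa using hi
        simp [this]
    rw [Finset.sum_congr rfl fun i _ => key i, ← Finset.mul_sum]
    by_cases hd : ∑ p, γ p = d + 1
    · rw [if_pos hd, if_pos hd]
      have : ∑ i, (γ i : ℝ) = d + 1 := by exact_mod_cast hd
      rw [this, Nat.factorial_succ]; push_cast; ring
    · rw [if_neg hd, if_neg hd]; simp

/-- Nonnegative multiples of generating polynomials of good weights. -/
def GoodP {q : ℕ} (p : MvPolynomial (Fin q) ℝ) : Prop :=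
  ∃ (c : ℝ) (d : ℕ) (w : (Fin q → ℕ) → ℝ), GoodW d w ∧ p = C c * genP d w

theorem GoodP.pderiv {q : ℕ} {p : MvPolynomial (Fin q) ℝ} (h : GoodP p) (i : Fin q) :
    GoodP (MvPolynomial.pderiv i p) := by
  obtain ⟨c, d, w, hw, rfl⟩ := h
  cases d with
  | zero => exact ⟨0, 0, w, hw, by simp [genP]⟩
  | succ d =>
    refine ⟨c * ((d : ℝ) + 1), d, shW i w, hw.shift i, ?_⟩
    rw [pderiv_C_mul, pderiv_genP, C_mul, mul_assoc]


theorem GoodP.pderivMulti {q : ℕ} {p : MvPolynomial (Fin q) ℝ} (h : GoodP p) (β : Fin q → ℕ) :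
    GoodP (pderivMulti β p) := by
  unfold _root_.pderivMulti
  induction (List.finRange q) with
  | nil => exact h
  | cons i t ih =>
    rw [List.foldr_cons]
    generalize List.foldr _ p t = r at ih
    induction β i with
    | zero => exact ih
    | succ m ihm =>
      rw [Function.iterate_succ_apply']
      exact ihm.pderiv i

theorem goodW_exp {n q : ℕ} (T : ℝ) (hT : 0 ≤ T)
    (Φ : (Fin q → ℕ) → ℝ)
    (hM : ∀ α β : Fin q → ℕ, (∑ p, α p) = n → (∑ p, β p) = n →
      ∀ i : Fin q, β i < α i →
        ∃ j : Fin q, α j < β j ∧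
          Φ (exchangeMove α i j) + Φ (exchangeMove β j i) ≤ Φ α + Φ β) :
    GoodW n (fun α => Real.exp (-T * Φ α)) := by
  refine ⟨fun γ => Real.exp_pos _, fun μ hμ i j k l => ?_⟩
  by_cases h1 : i = k
  · subst h1
    refine le_max_of_le_right (le_of_eq ?_)
    simp only [add_right_comm μ (Pi.single j 1) (Pi.single i 1)]
    ring
  by_cases h2 : i = l
  · subst h2
    refine le_max_of_le_left (le_of_eq ?_)
    simp only [add_right_comm μ (Pi.single j 1) (Pi.single i 1),
      add_right_comm μ (Pi.single k 1) (Pi.single i 1)]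
    ring
  have hsum : ∀ a b : Fin q, ∑ p, (μ + Pi.single a 1 + Pi.single b 1 : Fin q → ℕ) p = n := by
    intro a b
    simp [Finset.sum_add_distrib]; omega
  obtain ⟨m, hm, hle⟩ := hM (μ + Pi.single i 1 + Pi.single j 1) (μ + Pi.single k 1 + Pi.single l 1)
    (hsum i j) (hsum k l) i (by simp [Pi.single_apply, h1, h2]; omega)
  have hex : ∀ a b c : Fin q, exchangeMove (μ + Pi.single a 1 + Pi.single b 1) a c =
      μ + Pi.single b 1 + Pi.single c 1 := by
    intro a b c
    funext p
    simp only [exchangeMove, Pi.add_apply, Pi.single_apply]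
    split_ifs <;> omega
  have hmkl : m = k ∨ m = l := by
    by_contra hcon
    push Not at hcon
    simp [Pi.single_apply, hcon.1, hcon.2] at hm
    omega
  have fin : ∀ a b c d : ℝ, a + b ≤ c + d →
      Real.exp (-T * c) * Real.exp (-T * d) ≤ Real.exp (-T * a) * Real.exp (-T * b) := by
    intro a b c d h
    rw [← Real.exp_add, ← Real.exp_add]
    apply Real.exp_le_exp.mpr
    nlinarith
  rcases hmkl with rfl | rfl
  · refine le_max_of_le_right ?_
    rw [hex, hex] at hle
    rw [add_right_comm μ (Pi.single i 1) (Pi.single l 1), mul_comm (Real.exp (-T * Φ (μ + Pi.single l 1 + _)))]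
    exact fin _ _ _ _ hle
  · refine le_max_of_le_left ?_
    rw [hex, add_right_comm μ (Pi.single k 1) (Pi.single m 1), hex] at hle
    rw [add_right_comm μ (Pi.single i 1) (Pi.single k 1), mul_comm (Real.exp (-T * Φ (μ + Pi.single k 1 + _))),
      add_right_comm μ (Pi.single k 1) (Pi.single m 1)]
    exact fin _ _ _ _ hle

theorem genP_eq {n q : ℕ} (w : (Fin q → ℕ) → ℝ) :
    (∑ α ∈ loadProfiles n q,
        MvPolynomial.monomial (Finsupp.equivFunOnFinite.symm α)
          ((Nat.factorial n : ℝ) / (∏ p, Nat.factorial (α p) : ℕ) * w α)) = genP n w := by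
  ext γ
  rw [coeff_genP, coeff_sum]
  simp only [coeff_monomial]
  have hmem : (⇑γ : Fin q → ℕ) ∈ loadProfiles n q ↔ ∑ p, γ p = n := by
    simp only [loadProfiles, mem_filter, Fintype.mem_piFinset, mem_range, and_iff_right_iff_imp]
    intro h p
    have := Finset.single_le_sum (f := fun p => γ p) (fun i _ => Nat.zero_le _) (mem_univ p)
    omega
  have heq : ∀ α : Fin q → ℕ, (Finsupp.equivFunOnFinite.symm α = γ) ↔ α = ⇑γ := by
    intro α
    rw [Equiv.symm_apply_eq]; rfl
  simp only [heq]
  rw [Finset.sum_ite_eq']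
  simp only [hmem]

theorem psd_of_good {q : ℕ} [Nonempty (Fin q)] {p : MvPolynomial (Fin q) ℝ} (hp : GoodP p)
    (x : Fin q → ℝ) (hx : ∀ i, 0 ≤ x i) (y : Fin q → ℝ) :
    eval x p * bilF (fun i j => eval x (pderiv i (pderiv j p))) y y ≤
      (∑ j, eval x (pderiv j p) * y j) ^ 2 := by
  obtain ⟨c, d, w, hw, rfl⟩ := hp
  match d, hw with
  | 0, hw => simp [genP, bilF]
  | 1, hw =>
    have : ∀ i j, eval x (pderiv i (pderiv j (C c * genP 1 w))) = 0 := by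
      intro i j
      rw [pderiv_C_mul, pderiv_genP]
      simp [genP]
    simp only [this, bilF]
    simp only [zero_mul, Finset.sum_const_zero, mul_zero]
    positivity
  | d + 2, hw =>
    have h1 : ∀ j, eval x (pderiv j (C c * genP (d + 2) w)) =
        c * (d + 2) * genF (d + 1) (shW j w) x := by
      intro j
      rw [pderiv_C_mul, pderiv_genP]
      simp only [map_mul, eval_C, eval_genP]
      push_cast; ring
    have h2 : ∀ i j, eval x (pderiv i (pderiv j (C c * genP (d + 2) w))) =
        c * (d + 2) * (d + 1) * genF d (shW i (shW j w)) x := by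
      intro i j
      rw [pderiv_C_mul, pderiv_genP, pderiv_C_mul, pderiv_C_mul, pderiv_genP]
      simp only [map_mul, eval_C, eval_genP]
      push_cast; ring
    have h3 := lor_closed d w hw x hx y
    simp only [h1, h2, map_mul, eval_C, eval_genP]
    have e1 : bilF (fun i j => c * (d + 2) * (d + 1) * genF d (shW i (shW j w)) x) y y =
        c * (d + 2) * (d + 1) * bilF (fun i j => genF d (shW i (shW j w)) x) y y := by
      unfold bilF
      simp_rw [Finset.mul_sum]
      refine Finset.sum_congr rfl fun i _ => Finset.sum_congr rfl fun j _ => by ring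
    have e2 : ∑ j, c * (d + 2) * genF (d + 1) (shW j w) x * y j =
        c * (d + 2) * ∑ j, genF (d + 1) (shW j w) x * y j := by
      rw [Finset.mul_sum]
      refine Finset.sum_congr rfl fun i _ => by ring
    rw [e1, e2]
    set Q := ∑ j, genF (d + 1) (shW j w) x * y j
    set S := bilF (fun i j => genF d (shW i (shW j w)) x) y y
    have hk : 0 ≤ c ^ 2 * ((d : ℝ) + 2) * (d + 1) := by positivity
    have hk2 : 0 ≤ c ^ 2 * ((d : ℝ) + 2) * Q ^ 2 := by positivity
    have := mul_le_mul_of_nonneg_left h3 hk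
    nlinarith

/-- if `Φ : L → ℝ` is M-convex on `L = {α ∈ ℕ^q : Σ_p α_p = n}` and `T ≥ 0`,
then the `n`-homogeneous generating polynomial
`g(x) = Σ_{α ∈ L} (n!/α!)·e^{−T·Φ(α)}·x^α` is strongly log-concave. (For extension
parallel congestion games, Rosenthal's potential on strategy load profiles is M-convex,
and `n!/α!` counts the profiles with load profile `α`.) -/
theorem slc_of_M_convex_potential {n q : ℕ} (hq : 1 ≤ q) (T : ℝ) (hT : 0 ≤ T)
    (Φ : (Fin q → ℕ) → ℝ)
    (hM : ∀ α β : Fin q → ℕ, (∑ p, α p) = n → (∑ p, β p) = n →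
      ∀ i : Fin q, β i < α i →
        ∃ j : Fin q, α j < β j ∧
          Φ (exchangeMove α i j) + Φ (exchangeMove β j i) ≤ Φ α + Φ β) :
    StronglyLogConcave
      (∑ α ∈ loadProfiles n q,
        MvPolynomial.monomial (Finsupp.equivFunOnFinite.symm α)
          ((Nat.factorial n : ℝ) / (∏ p, Nat.factorial (α p) : ℕ) * Real.exp (-T * Φ α))) := by
  intro β x hx _
  have : Nonempty (Fin q) := ⟨⟨0, hq⟩⟩
  have hgood := goodW_exp T hT Φ hM
  rw [genP_eq (fun α => Real.exp (-T * Φ α))]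
  have hP : GoodP (genP n (fun α => Real.exp (-T * Φ α))) := ⟨1, n, _, hgood, by simp⟩
  have hQ := hP.pderivMulti β
  generalize pderivMulti β (genP n (fun α => Real.exp (-T * Φ α))) = p at hQ
  refine Matrix.PosSemidef.of_dotProduct_mulVec_nonneg ?_ ?_
  · have hc : ∀ i j, eval x (pderiv i (pderiv j p)) = eval x (pderiv j (pderiv i p)) := by
      intro i j
      obtain ⟨c, d, w, hw, rfl⟩ := hQ
      match d, hw with
      | 0, hw => simp [genP]
      | 1, hw =>
        simp only [pderiv_C_mul, pderiv_genP]
        simp [genP]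
      | d + 2, hw =>
        simp only [pderiv_C_mul, pderiv_genP]
        rw [shW_comm]
    ext i j
    simp only [Matrix.conjTranspose_apply, Matrix.neg_apply, Matrix.of_apply, star_trivial]
    rw [hc i j]; ring
  · intro y
    have h := psd_of_good hQ x hx y
    have e : star y ⬝ᵥ ((-(Matrix.of fun i j : Fin q =>
        MvPolynomial.eval x p * MvPolynomial.eval x (MvPolynomial.pderiv i (MvPolynomial.pderiv j p))
          - MvPolynomial.eval x (MvPolynomial.pderiv i p)
            * MvPolynomial.eval x (MvPolynomial.pderiv j p))).mulVec y) =
        (∑ j, eval x (pderiv j p) * y j) ^ 2 -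
        eval x p * bilF (fun i j => eval x (pderiv i (pderiv j p))) y y := by
      unfold bilF
      rw [sq, Finset.sum_mul_sum]
      simp only [dotProduct, Matrix.mulVec, Finset.mul_sum, ← Finset.sum_sub_distrib,
        Matrix.neg_apply, Matrix.of_apply, star_trivial]
      refine Finset.sum_congr rfl fun i _ => Finset.sum_congr rfl fun j _ => ?_
      ring
    rw [e]
    linarith
end
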